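/- arXiv:math/0501019 — 2 statements merged into one kernel-verified Lean document; each statement's English description precedes it below -/
import Mathlib

section
/- The operator U(α̂* ⊕ α̂*)U* − π'(α*) on 𝓗 belongs to K_q, the smallest norm-closed two-sided ideal of the bounded operators on 𝓗 containing the diagonal operator Γ_q : u^n_{ij} ↦ q^n u^n_{ij}, d^n_{ij} ↦ q^n d^n_{ij}. -/
noncomputable section

open Real

/-- Validity of an index triple `(N, I, J)` encoding `n = N/2`, `i = I/2`, `j = J/2`, with
`n ∈ ½ℤ₊` and `i, j ∈ {-n, -n+1, …, n}` (so `|I| ≤ N`, `|J| ≤ N` and `I ≡ J ≡ N (mod 2)`). -/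
abbrev validH (x : ℤ × ℤ × ℤ) : Prop :=
  0 ≤ x.1 ∧ |x.2.1| ≤ x.1 ∧ |x.2.2| ≤ x.1 ∧
    (x.1 + x.2.1) % 2 = 0 ∧ (x.1 + x.2.2) % 2 = 0

abbrev IdxH : Type := {x : ℤ × ℤ × ℤ // validH x}

/-- The Hilbert space `H = L₂(h)` with orthonormal basis `e^(n)_{ij}`. -/
abbrev Hsp : Type := lp (fun _ : IdxH => ℂ) 2

/-- The basis vector `e^(n)_{ij}` of `H`, where `n = N/2`, `i = I/2`, `j = J/2`;
it is `0` if the indices are out of range. -/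
def eH (N I J : ℤ) : Hsp :=
  if h : validH (N, I, J) then lp.single 2 (⟨(N, I, J), h⟩ : IdxH) (1 : ℂ) else 0

/-- the coefficient `q^(2n+i+j+1)` (here `n = N/2`, `i = I/2`, `j = J/2`) -/
def aC1 (q : ℝ) (N I J : ℤ) : ℝ := q ^ ((N : ℝ) + ((I : ℝ) + (J : ℝ)) / 2 + 1)

/-- the coefficient `(1-q^(2n+2i))^(1/2) * (1-q^(2n+2j))^(1/2)` -/
def aC2 (q : ℝ) (N I J : ℤ) : ℝ :=
  Real.sqrt (1 - q ^ ((N : ℝ) + (I : ℝ))) * Real.sqrt (1 - q ^ ((N : ℝ) + (J : ℝ)))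

/-- the coefficient `-q^(n+j) * (1-q^(2n+2i+2))^(1/2)` -/
def bC1 (q : ℝ) (N I J : ℤ) : ℝ :=
  -(q ^ (((N : ℝ) + (J : ℝ)) / 2)) * Real.sqrt (1 - q ^ ((N : ℝ) + (I : ℝ) + 2))

/-- the coefficient `q^(n+i) * (1-q^(2n+2j))^(1/2)` -/
def bC2 (q : ℝ) (N I J : ℤ) : ℝ :=
  q ^ (((N : ℝ) + (I : ℝ)) / 2) * Real.sqrt (1 - q ^ ((N : ℝ) + (J : ℝ)))

/-- `A` acts on the basis vectors of `H` by the defining formula of `α̂`: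
`α̂ e^(n)_{ij} = q^(2n+i+j+1) e^(n+1/2)_{i-1/2,j-1/2}
  + (1-q^(2n+2i))^(1/2) (1-q^(2n+2j))^(1/2) e^(n-1/2)_{i-1/2,j-1/2}`. -/
def IsAlphaHat (q : ℝ) (A : Hsp →L[ℂ] Hsp) : Prop :=
  ∀ N I J : ℤ, validH (N, I, J) →
    A (eH N I J) = (aC1 q N I J : ℂ) • eH (N + 1) (I - 1) (J - 1)
      + (aC2 q N I J : ℂ) • eH (N - 1) (I - 1) (J - 1)

/-- `B` acts on the basis vectors of `H` by the defining formula of `β̂`: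
`β̂ e^(n)_{ij} = -q^(n+j) (1-q^(2n+2i+2))^(1/2) e^(n+1/2)_{i+1/2,j-1/2}
  + q^(n+i) (1-q^(2n+2j))^(1/2) e^(n-1/2)_{i+1/2,j-1/2}`. -/
def IsBetaHat (q : ℝ) (B : Hsp →L[ℂ] Hsp) : Prop :=
  ∀ N I J : ℤ, validH (N, I, J) →
    B (eH N I J) = (bC1 q N I J : ℂ) • eH (N + 1) (I + 1) (J - 1)
      + (bC2 q N I J : ℂ) • eH (N - 1) (I + 1) (J - 1)

/-- The q-number `[m] = (q^m - q^(-m))/(q - q⁻¹)`. -/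
def qnum (q m : ℝ) : ℝ := (q ^ m - q ^ (-m)) / (q - q⁻¹)

/-- The 2×2 matrix `a⁺_{nij}`. -/
def aP (q n i j : ℝ) : Matrix (Fin 2) (Fin 2) ℝ :=
  (q ^ ((i + j - 1/2) / 2) * Real.sqrt (qnum q (n + i + 1))) •
    !![q ^ (-n - 1/2) * Real.sqrt (qnum q (n + j + 3/2)) / qnum q (2*n + 2), 0;
       q ^ ((1:ℝ)/2) * Real.sqrt (qnum q (n - j + 1/2)) / (qnum q (2*n + 1) * qnum q (2*n + 2)),
       q ^ (-n) * Real.sqrt (qnum q (n + j + 1/2)) / qnum q (2*n + 1)]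

/-- The 2×2 matrix `a⁻_{nij}`. -/
def aM (q n i j : ℝ) : Matrix (Fin 2) (Fin 2) ℝ :=
  (q ^ ((i + j - 1/2) / 2) * Real.sqrt (qnum q (n - i))) •
    !![q ^ (n + 1) * Real.sqrt (qnum q (n - j + 1/2)) / qnum q (2*n + 1),
       -(q ^ ((1:ℝ)/2) * Real.sqrt (qnum q (n + j + 1/2)) / (qnum q (2*n) * qnum q (2*n + 1)));
       0, q ^ (n + 1/2) * Real.sqrt (qnum q (n - j - 1/2)) / qnum q (2*n)]

/-- The 2×2 matrix `b⁺_{nij}`. -/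
def bP (q n i j : ℝ) : Matrix (Fin 2) (Fin 2) ℝ :=
  (q ^ ((i + j - 1/2) / 2) * Real.sqrt (qnum q (n + i + 1))) •
    !![Real.sqrt (qnum q (n - j + 3/2)) / qnum q (2*n + 2), 0;
       -(q ^ (-n - 1) * Real.sqrt (qnum q (n + j + 1/2)) / (qnum q (2*n + 1) * qnum q (2*n + 2))),
       q ^ (-(1:ℝ)/2) * Real.sqrt (qnum q (n - j + 1/2)) / qnum q (2*n + 1)]

/-- The 2×2 matrix `b⁻_{nij}`. -/
def bM (q n i j : ℝ) : Matrix (Fin 2) (Fin 2) ℝ :=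
  (q ^ ((i + j - 1/2) / 2) * Real.sqrt (qnum q (n - i))) •
    !![-(q ^ (-(1:ℝ)/2) * Real.sqrt (qnum q (n + j + 1/2)) / qnum q (2*n + 1)),
       -(q ^ n * Real.sqrt (qnum q (n - j + 1/2)) / (qnum q (2*n) * qnum q (2*n + 1)));
       0, -(Real.sqrt (qnum q (n + j - 1/2)) / qnum q (2*n))]

/-- `n` is a nonnegative half-integer: `n ∈ ½ℤ₊ = {0, 1/2, 1, 3/2, …}`. -/
def HalfNat (n : ℝ) : Prop := ∃ N : ℕ, (N : ℝ) = 2 * n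

/-- `i ∈ {-n, -n+1, …, n}`. -/
def IdxRange (n i : ℝ) : Prop := (∃ k : ℕ, (k : ℝ) = i + n) ∧ i ≤ n

/-- `j ∈ {-n+1/2, -n+3/2, …, n-1/2}`. -/
def JRangeIn (n j : ℝ) : Prop := (∃ k : ℕ, (k : ℝ) = j + n - 1/2) ∧ j ≤ n - 1/2

/-- `j ∈ {-n-1/2, -n+1/2, …, n+1/2}`. -/
def JRangeOut (n j : ℝ) : Prop := (∃ k : ℕ, (k : ℝ) = j + n + 1/2) ∧ j ≤ n + 1/2

/-- Validity of an index triple `(N, I, J)` (with `n = N/2`, `i = I/2`, `j = J/2`) for the basis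
vectors `u^n_{ij}` of `𝓗`: `n ∈ ½ℤ₊`, `i ∈ {-n, …, n}`, `j ∈ {-n-1/2, …, n+1/2}`. -/
abbrev validU (x : ℤ × ℤ × ℤ) : Prop :=
  0 ≤ x.1 ∧ |x.2.1| ≤ x.1 ∧ (x.1 + x.2.1) % 2 = 0 ∧
    |x.2.2| ≤ x.1 + 1 ∧ (x.1 + 1 + x.2.2) % 2 = 0

/-- Validity of an index triple `(N, I, J)` (with `n = N/2`, `i = I/2`, `j = J/2`) for the basis
vectors `d^n_{ij}` of `𝓗`: `n ≥ 1/2`, `i ∈ {-n, …, n}`, `j ∈ {-n+1/2, …, n-1/2}`. -/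
abbrev validD (x : ℤ × ℤ × ℤ) : Prop :=
  1 ≤ x.1 ∧ |x.2.1| ≤ x.1 ∧ (x.1 + x.2.1) % 2 = 0 ∧
    |x.2.2| ≤ x.1 - 1 ∧ (x.1 + 1 + x.2.2) % 2 = 0

abbrev IdxW : Type := {x : ℤ × ℤ × ℤ // validU x} ⊕ {x : ℤ × ℤ × ℤ // validD x}

/-- The Hilbert space `𝓗` with orthonormal basis `{u^n_{ij}} ∪ {d^n_{ij}}`. -/
abbrev Wsp : Type := lp (fun _ : IdxW => ℂ) 2

/-- The basis vector `u^n_{ij}` of `𝓗` (zero if out of range). -/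
def eU (N I J : ℤ) : Wsp :=
  if h : validU (N, I, J) then lp.single 2 (Sum.inl ⟨(N, I, J), h⟩ : IdxW) (1 : ℂ) else 0

/-- The basis vector `d^n_{ij}` of `𝓗` (zero if out of range, in particular for
`j = ±(n+1/2)`). -/
def eD (N I J : ℤ) : Wsp :=
  if h : validD (N, I, J) then lp.single 2 (Sum.inr ⟨(N, I, J), h⟩ : IdxW) (1 : ℂ) else 0

/-- The Hilbert space `H ⊕ H`. -/
abbrev Ksp : Type := WithLp 2 (Hsp × Hsp)

/-- `v ⊕ 0` as an element of `H ⊕ H` -/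
def eK1 (v : Hsp) : Ksp := (WithLp.equiv 2 (Hsp × Hsp)).symm (v, 0)

/-- `0 ⊕ v` as an element of `H ⊕ H` -/
def eK2 (v : Hsp) : Ksp := (WithLp.equiv 2 (Hsp × Hsp)).symm (0, v)

/-- `U : H ⊕ H → 𝓗` acts on the basis vectors by `U(e^(n)_{ij} ⊕ 0) = d^n_{i,j+1/2}` for
`-n ≤ j ≤ n-1`, `U(e^(n)_{in} ⊕ 0) = u^n_{i,n+1/2}`, and `U(0 ⊕ e^(n)_{ij}) = u^n_{i,j-1/2}`. -/
def IsUmap (U : Ksp ≃ₗᵢ[ℂ] Wsp) : Prop :=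
  (∀ N I J : ℤ, validH (N, I, J) → J ≠ N → U (eK1 (eH N I J)) = eD N I (J + 1)) ∧
  (∀ N I : ℤ, validH (N, I, N) → U (eK1 (eH N I N)) = eU N I (N + 1)) ∧
  (∀ N I J : ℤ, validH (N, I, J) → U (eK2 (eH N I J)) = eU N I (J - 1))

/-- the half-integer `N/2` as a real number -/
def nn (N : ℤ) : ℝ := (N : ℝ) / 2

/-- `P` acts on the basis vectors of `𝓗` by the defining formula of `π'(α*)`:
`π'(α*) v^n_{ij} = a⁺_{nij} v^(n+1/2)_{i+1/2,j+1/2} + a⁻_{nij} v^(n-1/2)_{i+1/2,j+1/2}`,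
where `v^n_{ij} = (u^n_{ij}, d^n_{ij})` and a matrix `M` applied to the source pair gives the
coefficient `M₁₁u + M₁₂d` of the target `u`-vector and `M₂₁u + M₂₂d` of the target `d`-vector. -/
def IsPiAlphaStar (q : ℝ) (P : Wsp →L[ℂ] Wsp) : Prop :=
  (∀ N I J : ℤ, validU (N, I, J) →
    P (eU N I J) =
      (aP q (nn N) (nn I) (nn J) 0 0 : ℂ) • eU (N + 1) (I + 1) (J + 1)
      + (aP q (nn N) (nn I) (nn J) 1 0 : ℂ) • eD (N + 1) (I + 1) (J + 1)
      + (aM q (nn N) (nn I) (nn J) 0 0 : ℂ) • eU (N - 1) (I + 1) (J + 1)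
      + (aM q (nn N) (nn I) (nn J) 1 0 : ℂ) • eD (N - 1) (I + 1) (J + 1)) ∧
  (∀ N I J : ℤ, validD (N, I, J) →
    P (eD N I J) =
      (aP q (nn N) (nn I) (nn J) 0 1 : ℂ) • eU (N + 1) (I + 1) (J + 1)
      + (aP q (nn N) (nn I) (nn J) 1 1 : ℂ) • eD (N + 1) (I + 1) (J + 1)
      + (aM q (nn N) (nn I) (nn J) 0 1 : ℂ) • eU (N - 1) (I + 1) (J + 1)
      + (aM q (nn N) (nn I) (nn J) 1 1 : ℂ) • eD (N - 1) (I + 1) (J + 1))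

/-- `P` acts on the basis vectors of `𝓗` by the defining formula of `π'(β)`:
`π'(β) v^n_{ij} = -(b⁺_{nij} v^(n+1/2)_{i+1/2,j-1/2} + b⁻_{nij} v^(n-1/2)_{i+1/2,j-1/2})`. -/
def IsPiBeta (q : ℝ) (P : Wsp →L[ℂ] Wsp) : Prop :=
  (∀ N I J : ℤ, validU (N, I, J) →
    P (eU N I J) =
      (-(bP q (nn N) (nn I) (nn J) 0 0) : ℂ) • eU (N + 1) (I + 1) (J - 1)
      + (-(bP q (nn N) (nn I) (nn J) 1 0) : ℂ) • eD (N + 1) (I + 1) (J - 1)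
      + (-(bM q (nn N) (nn I) (nn J) 0 0) : ℂ) • eU (N - 1) (I + 1) (J - 1)
      + (-(bM q (nn N) (nn I) (nn J) 1 0) : ℂ) • eD (N - 1) (I + 1) (J - 1)) ∧
  (∀ N I J : ℤ, validD (N, I, J) →
    P (eD N I J) =
      (-(bP q (nn N) (nn I) (nn J) 0 1) : ℂ) • eU (N + 1) (I + 1) (J - 1)
      + (-(bP q (nn N) (nn I) (nn J) 1 1) : ℂ) • eD (N + 1) (I + 1) (J - 1)
      + (-(bM q (nn N) (nn I) (nn J) 0 1) : ℂ) • eU (N - 1) (I + 1) (J - 1)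
      + (-(bM q (nn N) (nn I) (nn J) 1 1) : ℂ) • eD (N - 1) (I + 1) (J - 1))

/-- the direct sum `T ⊕ T` as a bounded operator on `H ⊕ H` -/
def dsum (T : Hsp →L[ℂ] Hsp) : Ksp →L[ℂ] Ksp :=
  (((WithLp.prodContinuousLinearEquiv 2 ℂ Hsp Hsp).symm : Hsp × Hsp →L[ℂ] Ksp)).comp
    ((T.prodMap T).comp
      ((WithLp.prodContinuousLinearEquiv 2 ℂ Hsp Hsp : Ksp ≃L[ℂ] Hsp × Hsp) : Ksp →L[ℂ] Hsp × Hsp))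

/-- `G` is the diagonal operator `Γ_q : u^n_{ij} ↦ q^n u^n_{ij}, d^n_{ij} ↦ q^n d^n_{ij}`. -/
def IsGammaQ (q : ℝ) (G : Wsp →L[ℂ] Wsp) : Prop :=
  (∀ N I J : ℤ, validU (N, I, J) →
    G (eU N I J) = ((q ^ ((N : ℝ) / 2) : ℝ) : ℂ) • eU N I J) ∧
  (∀ N I J : ℤ, validD (N, I, J) →
    G (eD N I J) = ((q ^ ((N : ℝ) / 2) : ℝ) : ℂ) • eD N I J)

theorem ContinuousLinearMap.hasSum_apply {ι E F : Type*} [NormedAddCommGroup E] [NormedSpace ℂ E]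
    [NormedAddCommGroup F] [NormedSpace ℂ F] {f : ι → E →L[ℂ] F} {S : E →L[ℂ] F}
    (h : HasSum f S) (v : E) : HasSum (fun x => f x v) (S v) :=
  (ContinuousLinearMap.apply ℂ F v).hasSum h

theorem TwoSidedIdeal.mem_of_summable_norm_single {ι : Type*} [DecidableEq ι]
    (I : TwoSidedIdeal (lp (fun _ : ι => ℂ) 2 →L[ℂ] lp (fun _ : ι => ℂ) 2))
    (hI : IsClosed (I : Set (lp (fun _ : ι => ℂ) 2 →L[ℂ] lp (fun _ : ι => ℂ) 2)))
    {G : lp (fun _ : ι => ℂ) 2 →L[ℂ] lp (fun _ : ι => ℂ) 2} (hG : G ∈ I) {g : ι → ℂ}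
    (hg : ∀ x, g x ≠ 0) (hGg : ∀ x, G (lp.single 2 x 1) = g x • lp.single 2 x 1)
    {T : lp (fun _ : ι => ℂ) 2 →L[ℂ] lp (fun _ : ι => ℂ) 2}
    (hT : Summable fun x => ‖T (lp.single 2 x 1)‖) : T ∈ I := by
  set e : ι → lp (fun _ : ι => ℂ) 2 := fun x => lp.single 2 x 1 with he
  have e_norm (x : ι) : ‖e x‖ = 1 := by
    simp [he, lp.norm_single]
  let p (x : ι) : lp (fun _ : ι => ℂ) 2 →L[ℂ] lp (fun _ : ι => ℂ) 2 :=
    (innerSL ℂ (e x)).smulRight (e x)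
  have hp (x : ι) (v : lp (fun _ : ι => ℂ) 2) : p x v = lp.single 2 x (v x) := by
    have h : lp.single (E := fun _ : ι => ℂ) 2 x (v x) = v x • e x := by
      rw [he, ← lp.single_smul]; simp
    simp [p, h, he, lp.inner_single_left]
  have hpI (x : ι) : T * p x ∈ I := by
    have h : p x = ((g x)⁻¹ • 1 : lp (fun _ : ι => ℂ) 2 →L[ℂ] lp (fun _ : ι => ℂ) 2) * (G * p x) := by
      ext1 v
      change inner ℂ (e x) v • e x = (g x)⁻¹ • G (inner ℂ (e x) v • e x)
      rw [map_smul, hGg, smul_comm _ (g x), inv_smul_smul₀ (hg x)]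
    rw [h]
    exact I.mul_mem_left _ _ (I.mul_mem_left _ _ (I.mul_mem_right _ _ hG))
  have hnorm (x : ι) : ‖T * p x‖ ≤ ‖T (e x)‖ := by
    refine ContinuousLinearMap.opNorm_le_bound _ (norm_nonneg _) fun v => ?_
    change ‖T (inner ℂ (e x) v • e x)‖ ≤ _
    rw [map_smul, norm_smul, mul_comm]
    gcongr
    simpa [e_norm] using norm_inner_le_norm (𝕜 := ℂ) (e x) v
  have hs : Summable fun x => T * p x := .of_norm_bounded hT hnorm
  have hsum : ∑' x, T * p x = T := by
    ext1 v
    have h1 := ContinuousLinearMap.hasSum_apply hs.hasSum v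
    have h2 : HasSum (fun x => (T * p x) v) (T v) := by
      have := T.hasSum (lp.hasSum_single (by norm_num) v)
      simpa [hp] using this
    exact h1.unique h2
  rw [← hsum]
  exact hI.mem_of_tendsto hs.hasSum (.of_forall fun s => sum_mem fun x _ => hpI x)

/-- The cutoff factor `(1 - q^(2a))^(1/2)`. -/
def sqrtOneSub (q a : ℝ) : ℝ := √(1 - q ^ (2 * a))

theorem sqrtOneSub_nonneg (q a : ℝ) : 0 ≤ sqrtOneSub q a := Real.sqrt_nonneg _

theorem sqrtOneSub_le_one {q : ℝ} (hq0 : 0 < q) (a : ℝ) : sqrtOneSub q a ≤ 1 :=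
  Real.sqrt_le_one.2 (by have := rpow_pos_of_pos hq0 (2 * a); linarith)

theorem one_sub_sqrtOneSub_le {q : ℝ} (hq0 : 0 < q) (a : ℝ) :
    1 - sqrtOneSub q a ≤ q ^ (2 * a) := by
  have h0 := sqrtOneSub_nonneg q a
  have h1 := sqrtOneSub_le_one hq0 a
  rcases le_total (q ^ (2 * a)) 1 with h | h
  · have h2 : sqrtOneSub q a ^ 2 = 1 - q ^ (2 * a) := Real.sq_sqrt (by linarith)
    nlinarith
  · linarith

theorem qnum_eq {q : ℝ} (hq0 : 0 < q) (m : ℝ) :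
    qnum q m = q ^ (-m) / (q⁻¹ - q) * (1 - q ^ (2 * m)) := by
  have h : q ^ (-m) * q ^ (2 * m) = q ^ m := by rw [← rpow_add hq0]; ring_nf
  rw [qnum, ← neg_sub q⁻¹ q, div_neg, ← neg_div, div_mul_eq_mul_div, mul_sub, h]
  ring

theorem sqrt_qnum {q : ℝ} (hq0 : 0 < q) (hq1 : q < 1) (m : ℝ) :
    √(qnum q m) = q ^ (-m / 2) / √(q⁻¹ - q) * sqrtOneSub q m := by
  have hc : 0 < q⁻¹ - q := by have := (one_lt_inv₀ hq0).2 hq1; linarith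
  rw [qnum_eq hq0, Real.sqrt_mul (div_pos (rpow_pos_of_pos hq0 _) hc).le,
    Real.sqrt_div (rpow_pos_of_pos hq0 _).le, Real.sqrt_eq_rpow (q ^ (-m)), ← rpow_mul hq0.le,
    sqrtOneSub]
  ring_nf

theorem rpow_mul_sqrt_qnum_mul_div {q : ℝ} (hq0 : 0 < q) (hq1 : q < 1) (x y a b d : ℝ) :
    q ^ x * √(qnum q a) * (q ^ y * √(qnum q b) / qnum q d) =
      q ^ (x + y + d - (a + b) / 2) *
        (sqrtOneSub q a * sqrtOneSub q b / (1 - q ^ (2 * d))) := by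
  have hc : 0 < q⁻¹ - q := by have := (one_lt_inv₀ hq0).2 hq1; linarith
  have hs : √(q⁻¹ - q) ^ 2 = q⁻¹ - q := Real.sq_sqrt hc.le
  have hs0 : √(q⁻¹ - q) ≠ 0 := (Real.sqrt_pos.2 hc).ne'
  have he : q ^ (x + y + d - (a + b) / 2) =
      q ^ x * q ^ y * (q ^ (-d))⁻¹ * q ^ (-a / 2) * q ^ (-b / 2) := by
    rw [← rpow_neg hq0.le, ← rpow_add hq0, ← rpow_add hq0, ← rpow_add hq0, ← rpow_add hq0]
    ring_nf
  rw [sqrt_qnum hq0 hq1, sqrt_qnum hq0 hq1, qnum_eq hq0, he]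
  generalize √(q⁻¹ - q) = k at *
  rw [← hs]
  have := rpow_pos_of_pos hq0 (-d)
  generalize (1 - q ^ (2 * d)) = D
  field_simp

theorem inv_qnum {q : ℝ} (hq0 : 0 < q) (m : ℝ) :
    (qnum q m)⁻¹ = (q⁻¹ - q) * q ^ m * (1 - q ^ (2 * m))⁻¹ := by
  rw [qnum_eq hq0, mul_inv, inv_div, rpow_neg hq0.le, div_inv_eq_mul]

section Entries

variable {q : ℝ} (hq0 : 0 < q) (hq1 : q < 1) (n i j : ℝ)
include hq0 hq1

theorem aP_zero_zero : aP q n i j 0 0 =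
    sqrtOneSub q (n + i + 1) * sqrtOneSub q (n + j + 3 / 2) / (1 - q ^ (2 * (2 * n + 2))) := by
  have h := rpow_mul_sqrt_qnum_mul_div hq0 hq1 ((i + j - 1 / 2) / 2) (-n - 1 / 2) (n + i + 1)
    (n + j + 3 / 2) (2 * n + 2)
  rw [show (i + j - 1 / 2) / 2 + (-n - 1 / 2) + (2 * n + 2) - (n + i + 1 + (n + j + 3 / 2)) / 2 = 0
    by ring, rpow_zero, one_mul] at h
  simpa [aP] using h

theorem aP_one_one : aP q n i j 1 1 =
    sqrtOneSub q (n + i + 1) * sqrtOneSub q (n + j + 1 / 2) / (1 - q ^ (2 * (2 * n + 1))) := by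
  have h := rpow_mul_sqrt_qnum_mul_div hq0 hq1 ((i + j - 1 / 2) / 2) (-n) (n + i + 1)
    (n + j + 1 / 2) (2 * n + 1)
  rw [show (i + j - 1 / 2) / 2 + (-n) + (2 * n + 1) - (n + i + 1 + (n + j + 1 / 2)) / 2 = 0
    by ring, rpow_zero, one_mul] at h
  simpa [aP] using h

theorem aM_zero_zero : aM q n i j 0 0 = q ^ (2 * n + i + j + 3 / 2) *
    (sqrtOneSub q (n - i) * sqrtOneSub q (n - j + 1 / 2) / (1 - q ^ (2 * (2 * n + 1)))) := by
  have h := rpow_mul_sqrt_qnum_mul_div hq0 hq1 ((i + j - 1 / 2) / 2) (n + 1) (n - i)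
    (n - j + 1 / 2) (2 * n + 1)
  rw [show (i + j - 1 / 2) / 2 + (n + 1) + (2 * n + 1) - (n - i + (n - j + 1 / 2)) / 2 =
    2 * n + i + j + 3 / 2 by ring] at h
  simpa [aM] using h

theorem aM_one_one : aM q n i j 1 1 = q ^ (2 * n + i + j + 1 / 2) *
    (sqrtOneSub q (n - i) * sqrtOneSub q (n - j - 1 / 2) / (1 - q ^ (2 * (2 * n)))) := by
  have h := rpow_mul_sqrt_qnum_mul_div hq0 hq1 ((i + j - 1 / 2) / 2) (n + 1 / 2) (n - i)
    (n - j - 1 / 2) (2 * n)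
  rw [show (i + j - 1 / 2) / 2 + (n + 1 / 2) + (2 * n) - (n - i + (n - j - 1 / 2)) / 2 =
    2 * n + i + j + 1 / 2 by ring] at h
  simpa [aM] using h

theorem aP_one_zero : aP q n i j 1 0 = (q⁻¹ - q) * q ^ (3 * n + j + 5 / 2) *
    (sqrtOneSub q (n + i + 1) * sqrtOneSub q (n - j + 1 / 2) / (1 - q ^ (2 * (2 * n + 2)))) /
      (1 - q ^ (2 * (2 * n + 1))) := by
  have h := rpow_mul_sqrt_qnum_mul_div hq0 hq1 ((i + j - 1 / 2) / 2) (1 / 2) (n + i + 1)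
    (n - j + 1 / 2) (2 * n + 2)
  have h' : aP q n i j 1 0 = (q ^ ((i + j - 1 / 2) / 2) * √(qnum q (n + i + 1)) *
      (q ^ ((1 : ℝ) / 2) * √(qnum q (n - j + 1 / 2)) / qnum q (2 * n + 2))) *
        (qnum q (2 * n + 1))⁻¹ := by
    simp only [aP, Matrix.smul_apply, smul_eq_mul, Matrix.of_apply, Matrix.cons_val_zero,
      Matrix.cons_val_one]
    ring
  rw [h', h, inv_qnum hq0, show 3 * n + j + 5 / 2 =
    ((i + j - 1 / 2) / 2 + 1 / 2 + (2 * n + 2) - (n + i + 1 + (n - j + 1 / 2)) / 2) + (2 * n + 1)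
    by ring, rpow_add hq0 _ (2 * n + 1)]
  ring

theorem aM_zero_one : aM q n i j 0 1 = -((q⁻¹ - q) * q ^ (3 * n + i + 1) *
    (sqrtOneSub q (n - i) * sqrtOneSub q (n + j + 1 / 2) / (1 - q ^ (2 * (2 * n + 1)))) /
      (1 - q ^ (2 * (2 * n)))) := by
  have h := rpow_mul_sqrt_qnum_mul_div hq0 hq1 ((i + j - 1 / 2) / 2) (1 / 2) (n - i)
    (n + j + 1 / 2) (2 * n + 1)
  have h' : aM q n i j 0 1 = -((q ^ ((i + j - 1 / 2) / 2) * √(qnum q (n - i)) *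
      (q ^ ((1 : ℝ) / 2) * √(qnum q (n + j + 1 / 2)) / qnum q (2 * n + 1))) *
        (qnum q (2 * n))⁻¹) := by
    simp only [aM, Matrix.smul_apply, smul_eq_mul, Matrix.of_apply, Matrix.cons_val_zero,
      Matrix.cons_val_one]
    ring
  rw [h', h, inv_qnum hq0, show 3 * n + i + 1 =
    ((i + j - 1 / 2) / 2 + 1 / 2 + (2 * n + 1) - (n - i + (n + j + 1 / 2)) / 2) + (2 * n)
    by ring, rpow_add hq0 _ (2 * n)]
  ring

end Entries

theorem abs_mul_div_sub_mul_le {s t t' y B : ℝ} (hs0 : 0 ≤ s) (hs1 : s ≤ 1) (ht0 : 0 ≤ t)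
    (ht1 : t ≤ 1) (hy0 : 0 ≤ y) (hy1 : y < 1) (hB : (1 - y)⁻¹ ≤ B) :
    |s * t / (1 - y) - s * t'| ≤ B * y + |t - t'| := by
  have hy : 0 < 1 - y := by linarith
  have h : s * t / (1 - y) - s * t' = s * t * ((1 - y)⁻¹ * y) + s * (t - t') := by
    field_simp; ring
  have hst : s * t ≤ 1 := mul_le_one₀ hs1 ht0 ht1
  rw [h]
  refine (abs_add_le _ _).trans (add_le_add ?_ ?_)
  · rw [abs_of_nonneg (by positivity)]
    calc s * t * ((1 - y)⁻¹ * y) ≤ 1 * (B * y) := by gcongr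
      _ = B * y := one_mul _
  · rw [abs_mul, abs_of_nonneg hs0]
    exact mul_le_of_le_one_left (abs_nonneg _) hs1

theorem abs_mul_div_le {s t y B : ℝ} (hs0 : 0 ≤ s) (hs1 : s ≤ 1) (ht0 : 0 ≤ t)
    (ht1 : t ≤ 1) (hy1 : y < 1) (hB : (1 - y)⁻¹ ≤ B) :
    |s * t / (1 - y)| ≤ B := by
  have hy : 0 < 1 - y := by linarith
  have hst : s * t ≤ 1 := mul_le_one₀ hs1 ht0 ht1
  rw [abs_of_nonneg (by positivity), div_eq_mul_inv]
  calc s * t * (1 - y)⁻¹ ≤ 1 * B := by gcongr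
    _ = B := one_mul _

theorem abs_mul_mul_div_sub_le {p s t y B : ℝ} (hp0 : 0 ≤ p) (hs0 : 0 ≤ s) (hs1 : s ≤ 1)
    (ht0 : 0 ≤ t) (ht1 : t ≤ 1) (hy0 : 0 ≤ y) (hy1 : y < 1) (hB : (1 - y)⁻¹ ≤ B) :
    |p * (s * t / (1 - y)) - p| ≤ B * (p * y) + p * (1 - s) + p * (1 - t) := by
  have h1 := abs_mul_div_sub_mul_le (t' := 1) hs0 hs1 ht0 ht1 hy0 hy1 hB
  rw [abs_sub_comm t 1, abs_of_nonneg (by linarith : 0 ≤ 1 - t)] at h1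
  have h : p * (s * t / (1 - y)) - p = p * (s * t / (1 - y) - s * 1) - p * (1 - s) := by ring
  rw [h]
  refine (abs_sub _ _).trans ?_
  rw [abs_mul, abs_of_nonneg hp0, abs_of_nonneg (mul_nonneg hp0 (by linarith : 0 ≤ 1 - s))]
  nlinarith [mul_le_mul_of_nonneg_left h1 hp0]

theorem inv_one_sub_rpow_le {q : ℝ} (hq0 : 0 < q) (hq1 : q < 1) {d : ℝ} (hd : 1 / 2 ≤ d) :
    q ^ (2 * d) < 1 ∧ (1 - q ^ (2 * d))⁻¹ ≤ (1 - q)⁻¹ := by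
  have h : q ^ (2 * d) ≤ q := by
    simpa using rpow_le_rpow_of_exponent_ge hq0 hq1.le (by linarith : (1 : ℝ) ≤ 2 * d)
  exact ⟨h.trans_lt hq1, inv_anti₀ (by linarith) (by linarith)⟩

theorem abs_aP_zero_zero_sub_le {q : ℝ} (hq0 : 0 < q) (hq1 : q < 1) {n i j b : ℝ} (hn : 0 ≤ n)
    (hb : b = n + j + 3 / 2 ∨ n ≤ b ∧ n ≤ n + j + 3 / 2) :
    |aP q n i j 0 0 - sqrtOneSub q (n + i + 1) * sqrtOneSub q b| ≤
      ((1 - q)⁻¹ + 1) * q ^ (2 * n) := by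
  obtain ⟨hy1, hB⟩ := inv_one_sub_rpow_le hq0 hq1 (d := 2 * n + 2) (by linarith)
  have h := abs_mul_div_sub_mul_le (t' := sqrtOneSub q b) (sqrtOneSub_nonneg q (n + i + 1))
    (sqrtOneSub_le_one hq0 _) (sqrtOneSub_nonneg q (n + j + 3 / 2)) (sqrtOneSub_le_one hq0 _)
    (rpow_pos_of_pos hq0 _).le hy1 hB
  rw [aP_zero_zero hq0 hq1]
  refine h.trans ?_
  rw [add_mul, one_mul]
  have hq2 : 0 < 1 - q := by linarith
  refine add_le_add (mul_le_mul_of_nonneg_left ?_ (by positivity)) ?_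
  · exact rpow_le_rpow_of_exponent_ge hq0 hq1.le (by linarith)
  · rcases hb with rfl | ⟨h1, h2⟩
    · simpa using (rpow_pos_of_pos hq0 _).le
    · have e1 := (one_sub_sqrtOneSub_le hq0 b).trans
        (rpow_le_rpow_of_exponent_ge hq0 hq1.le (by linarith : 2 * n ≤ 2 * b))
      have e2 := (one_sub_sqrtOneSub_le hq0 (n + j + 3 / 2)).trans
        (rpow_le_rpow_of_exponent_ge hq0 hq1.le (by linarith : 2 * n ≤ 2 * (n + j + 3 / 2)))
      have := sqrtOneSub_le_one hq0 b
      have := sqrtOneSub_le_one hq0 (n + j + 3 / 2)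
      rw [abs_le]
      constructor <;> linarith

theorem abs_aP_one_one_sub_le {q : ℝ} (hq0 : 0 < q) (hq1 : q < 1) {n i j : ℝ} (hn : 0 ≤ n) :
    |aP q n i j 1 1 - sqrtOneSub q (n + i + 1) * sqrtOneSub q (n + j + 1 / 2)| ≤
      (1 - q)⁻¹ * q ^ (2 * n) := by
  obtain ⟨hy1, hB⟩ := inv_one_sub_rpow_le hq0 hq1 (d := 2 * n + 1) (by linarith)
  have h := abs_mul_div_sub_mul_le (t' := sqrtOneSub q (n + j + 1 / 2))
    (sqrtOneSub_nonneg q (n + i + 1))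
    (sqrtOneSub_le_one hq0 _) (sqrtOneSub_nonneg q (n + j + 1 / 2)) (sqrtOneSub_le_one hq0 _)
    (rpow_pos_of_pos hq0 _).le hy1 hB
  rw [aP_one_one hq0 hq1]
  refine h.trans ?_
  rw [sub_self, abs_zero, add_zero]
  have hq2 : 0 < 1 - q := by linarith
  exact mul_le_mul_of_nonneg_left
    (rpow_le_rpow_of_exponent_ge hq0 hq1.le (by linarith)) (by positivity)

theorem abs_aM_zero_zero_sub_le {q : ℝ} (hq0 : 0 < q) (hq1 : q < 1) {n i j : ℝ} (hn : 0 ≤ n)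
    (hi : |i| ≤ n) (hj : |j| ≤ n + 1 / 2) :
    |aM q n i j 0 0 - q ^ (2 * n + i + j + 3 / 2)| ≤ ((1 - q)⁻¹ + 2) * q ^ (2 * n) := by
  obtain ⟨hy1, hB⟩ := inv_one_sub_rpow_le hq0 hq1 (d := 2 * n + 1) (by linarith)
  have hp := rpow_pos_of_pos hq0 (2 * n + i + j + 3 / 2)
  have h := abs_mul_mul_div_sub_le hp.le (sqrtOneSub_nonneg q (n - i))
    (sqrtOneSub_le_one hq0 _) (sqrtOneSub_nonneg q (n - j + 1 / 2)) (sqrtOneSub_le_one hq0 _)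
    (rpow_pos_of_pos hq0 _).le hy1 hB
  rw [aM_zero_zero hq0 hq1]
  refine h.trans ?_
  rw [abs_le] at hi hj
  rw [show ((1 - q)⁻¹ + 2) * q ^ (2 * n) =
    (1 - q)⁻¹ * q ^ (2 * n) + q ^ (2 * n) + q ^ (2 * n) by ring]
  have hq2 : 0 < 1 - q := by linarith
  refine add_le_add_three (mul_le_mul_of_nonneg_left ?_ (by positivity)) ?_ ?_
  · rw [← rpow_add hq0]
    exact rpow_le_rpow_of_exponent_ge hq0 hq1.le (by linarith)
  · refine (mul_le_mul_of_nonneg_left (one_sub_sqrtOneSub_le hq0 _) hp.le).trans ?_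
    rw [← rpow_add hq0]
    exact rpow_le_rpow_of_exponent_ge hq0 hq1.le (by linarith)
  · refine (mul_le_mul_of_nonneg_left (one_sub_sqrtOneSub_le hq0 _) hp.le).trans ?_
    rw [← rpow_add hq0]
    exact rpow_le_rpow_of_exponent_ge hq0 hq1.le (by linarith)

theorem abs_aM_one_one_sub_le {q : ℝ} (hq0 : 0 < q) (hq1 : q < 1) {n i j : ℝ} (hn : 1 / 2 ≤ n)
    (hi : |i| ≤ n) (hj : |j| ≤ n - 1 / 2) :
    |aM q n i j 1 1 - q ^ (2 * n + i + j + 1 / 2)| ≤ ((1 - q)⁻¹ + 2) * q ^ (2 * n) := by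
  obtain ⟨hy1, hB⟩ := inv_one_sub_rpow_le hq0 hq1 (d := 2 * n) (by linarith)
  have hp := rpow_pos_of_pos hq0 (2 * n + i + j + 1 / 2)
  have h := abs_mul_mul_div_sub_le hp.le (sqrtOneSub_nonneg q (n - i))
    (sqrtOneSub_le_one hq0 _) (sqrtOneSub_nonneg q (n - j - 1 / 2)) (sqrtOneSub_le_one hq0 _)
    (rpow_pos_of_pos hq0 _).le hy1 hB
  rw [aM_one_one hq0 hq1]
  refine h.trans ?_
  rw [abs_le] at hi hj
  rw [show ((1 - q)⁻¹ + 2) * q ^ (2 * n) =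
    (1 - q)⁻¹ * q ^ (2 * n) + q ^ (2 * n) + q ^ (2 * n) by ring]
  have hq2 : 0 < 1 - q := by linarith
  refine add_le_add_three (mul_le_mul_of_nonneg_left ?_ (by positivity)) ?_ ?_
  · rw [← rpow_add hq0]
    exact rpow_le_rpow_of_exponent_ge hq0 hq1.le (by linarith)
  · refine (mul_le_mul_of_nonneg_left (one_sub_sqrtOneSub_le hq0 _) hp.le).trans ?_
    rw [← rpow_add hq0]
    exact rpow_le_rpow_of_exponent_ge hq0 hq1.le (by linarith)
  · refine (mul_le_mul_of_nonneg_left (one_sub_sqrtOneSub_le hq0 _) hp.le).trans ?_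
    rw [← rpow_add hq0]
    exact rpow_le_rpow_of_exponent_ge hq0 hq1.le (by linarith)

theorem abs_mul_mul_div_div_le {q : ℝ} (hq0 : 0 < q) (hq1 : q < 1) {e n a b d d' : ℝ}
    (hd : 1 / 2 ≤ d) (hd' : 1 / 2 ≤ d') (he : 2 * n ≤ e) :
    |(q⁻¹ - q) * q ^ e * (sqrtOneSub q a * sqrtOneSub q b / (1 - q ^ (2 * d))) /
      (1 - q ^ (2 * d'))| ≤ (q⁻¹ - q) * (1 - q)⁻¹ ^ 2 * q ^ (2 * n) := by
  have hc : 0 < q⁻¹ - q := by have := (one_lt_inv₀ hq0).2 hq1; linarith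
  obtain ⟨hy1, hB⟩ := inv_one_sub_rpow_le hq0 hq1 hd
  obtain ⟨hy1', hB'⟩ := inv_one_sub_rpow_le hq0 hq1 hd'
  have h := abs_mul_div_le (sqrtOneSub_nonneg q a)
    (sqrtOneSub_le_one hq0 _) (sqrtOneSub_nonneg q b) (sqrtOneSub_le_one hq0 _) hy1 hB
  have he' := rpow_le_rpow_of_exponent_ge hq0 hq1.le he
  have hq2 : 0 < 1 - q := by linarith
  rw [div_eq_mul_inv _ (1 - q ^ (2 * d')), abs_mul, abs_mul, abs_mul, abs_of_pos hc,
    abs_of_pos (rpow_pos_of_pos hq0 e), abs_of_pos (inv_pos.2 (sub_pos.2 hy1'))]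
  calc _ ≤ (q⁻¹ - q) * q ^ (2 * n) * (1 - q)⁻¹ * (1 - q)⁻¹ := by
        gcongr
    _ = _ := by ring

theorem summable_rpow_abs {q : ℝ} (hq0 : 0 < q) (hq1 : q < 1) :
    Summable fun m : ℤ => q ^ |(m : ℝ)| := by
  have h : Summable fun k : ℕ => q ^ (k : ℝ) := by
    simpa using summable_geometric_of_lt_one hq0.le hq1
  exact Summable.of_nat_of_neg (by simpa using h) (by simpa using h)

theorem summable_rpow_of_abs_le {q : ℝ} (hq0 : 0 < q) (hq1 : q < 1) {ι : Type*}
    {f : ι → ℤ × ℤ × ℤ} (hf : Function.Injective f)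
    (h : ∀ x, 0 ≤ (f x).1 ∧ |(f x).2.1| ≤ (f x).1 ∧ |(f x).2.2| ≤ (f x).1 + 1) :
    Summable fun x => q ^ ((f x).1 : ℝ) := by
  have hr0 : 0 < q ^ (1 / 3 : ℝ) := rpow_pos_of_pos hq0 _
  have hr1 : q ^ (1 / 3 : ℝ) < 1 := rpow_lt_one hq0.le hq1 (by norm_num)
  have hs := summable_rpow_abs hr0 hr1
  have hs3 := hs.mul_of_nonneg (hs.mul_of_nonneg hs (fun _ => by positivity)
    (fun _ => by positivity)) (fun _ => by positivity) (fun _ => by positivity)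
  refine .of_nonneg_of_le (fun _ => by positivity) (fun x => ?_)
    ((hs3.comp_injective hf).mul_left (q ^ (-(1 / 3) : ℝ)))
  obtain ⟨h0, h1, h2⟩ := h x
  have h0' : (0 : ℝ) ≤ (f x).1 := by exact_mod_cast h0
  have h1' : |((f x).2.1 : ℝ)| ≤ (f x).1 := by exact_mod_cast h1
  have h2' : |((f x).2.2 : ℝ)| ≤ (f x).1 + 1 := by exact_mod_cast h2
  simp only [Function.comp_apply]
  rw [← rpow_mul hq0.le, ← rpow_mul hq0.le, ← rpow_mul hq0.le, ← rpow_add hq0, ← rpow_add hq0,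
    ← rpow_add hq0, abs_of_nonneg h0']
  exact rpow_le_rpow_of_exponent_ge hq0 hq1.le (by linarith)

theorem eH_apply (N I J : ℤ) (y : IdxH) : eH N I J y = if (N, I, J) = y.1 then 1 else 0 := by
  unfold eH
  split_ifs with h1 h2 h2
  · obtain ⟨y, hy⟩ := y
    obtain rfl : (N, I, J) = y := h2
    exact lp.single_apply_self 2 _ _
  · exact lp.single_apply_ne 2 _ _ fun h => h2 (by rw [h])
  · exact absurd (h2 ▸ y.2) h1
  · rfl

theorem eH_of_valid {N I J : ℤ} (h : validH (N, I, J)) :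
    eH N I J = lp.single 2 (⟨(N, I, J), h⟩ : IdxH) (1 : ℂ) := dif_pos h

theorem adjoint_eH {q : ℝ} {A : Hsp →L[ℂ] Hsp} (hA : IsAlphaHat q A) {N I J : ℤ}
    (h : validH (N, I, J)) :
    ContinuousLinearMap.adjoint A (eH N I J) =
      (aC1 q (N - 1) (I + 1) (J + 1) : ℂ) • eH (N - 1) (I + 1) (J + 1) +
        (aC2 q (N + 1) (I + 1) (J + 1) : ℂ) • eH (N + 1) (I + 1) (J + 1) := by
  ext ⟨⟨M, K, L⟩, hy⟩
  have h1 : ContinuousLinearMap.adjoint A (eH N I J) ⟨(M, K, L), hy⟩ =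
      inner ℂ (eH M K L) (ContinuousLinearMap.adjoint A (eH N I J)) := by
    rw [eH_of_valid hy, lp.inner_single_left]
    simp
  rw [h1, ContinuousLinearMap.adjoint_inner_right, hA _ _ _ hy, eH_of_valid h,
    lp.inner_single_right]
  simp only [lp.coeFn_add, lp.coeFn_smul, Pi.add_apply, Pi.smul_apply, eH_apply, Prod.mk.injEq,
    smul_eq_mul, mul_ite, mul_one, mul_zero]
  have e1 : (M + 1 = N ∧ K - 1 = I ∧ L - 1 = J) ↔ (N - 1 = M ∧ I + 1 = K ∧ J + 1 = L) := by omega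
  have e2 : (M - 1 = N ∧ K - 1 = I ∧ L - 1 = J) ↔ (N + 1 = M ∧ I + 1 = K ∧ J + 1 = L) := by omega
  simp only [e1, e2]
  split_ifs with h1 h2 h2
  · omega
  · obtain ⟨rfl, rfl, rfl⟩ := h1
    simp
  · obtain ⟨rfl, rfl, rfl⟩ := h2
    simp
  · simp

theorem norm_eU_le (N I J : ℤ) : ‖eU N I J‖ ≤ 1 := by
  unfold eU
  split_ifs
  · simp [lp.norm_single]
  · simp

theorem norm_eD_le (N I J : ℤ) : ‖eD N I J‖ ≤ 1 := by
  unfold eD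
  split_ifs
  · simp [lp.norm_single]
  · simp

theorem norm_eH_le (N I J : ℤ) : ‖eH N I J‖ ≤ 1 := by
  unfold eH
  split_ifs
  · simp [lp.norm_single]
  · simp

theorem norm_eK1 (v : Hsp) : ‖eK1 v‖ = ‖v‖ := by
  simp [eK1]

theorem norm_eK2 (v : Hsp) : ‖eK2 v‖ = ‖v‖ := by
  simp [eK2]

theorem eK1_smul_add_smul (a b : ℂ) (v w : Hsp) :
    eK1 (a • v + b • w) = a • eK1 v + b • eK1 w := by
  apply (WithLp.equiv 2 (Hsp × Hsp)).injective
  ext1 <;> simp [eK1]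

theorem eK2_smul_add_smul (a b : ℂ) (v w : Hsp) :
    eK2 (a • v + b • w) = a • eK2 v + b • eK2 w := by
  apply (WithLp.equiv 2 (Hsp × Hsp)).injective
  ext1 <;> simp [eK2]

theorem dsum_eK1 (T : Hsp →L[ℂ] Hsp) (v : Hsp) : dsum T (eK1 v) = eK1 (T v) := by
  apply (WithLp.equiv 2 (Hsp × Hsp)).injective
  ext1 <;> simp [eK1, dsum]

theorem dsum_eK2 (T : Hsp →L[ℂ] Hsp) (v : Hsp) : dsum T (eK2 v) = eK2 (T v) := by
  apply (WithLp.equiv 2 (Hsp × Hsp)).injective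
  ext1 <;> simp [eK2, dsum]

theorem eH_of_not_valid {N I J : ℤ} (h : ¬validH (N, I, J)) : eH N I J = 0 := dif_neg h

theorem eU_of_not_valid {N I J : ℤ} (h : ¬validU (N, I, J)) : eU N I J = 0 := dif_neg h

theorem eD_of_not_valid {N I J : ℤ} (h : ¬validD (N, I, J)) : eD N I J = 0 := dif_neg h

theorem eK1_zero : eK1 0 = 0 := rfl

theorem eK2_zero : eK2 0 = 0 := rfl

theorem norm_smul_sub_smul_le {E : Type*} [NormedAddCommGroup E] [NormedSpace ℂ E] {x y : E}
    (hx : ‖x‖ ≤ 1) (hy : ‖y‖ ≤ 1) {p m B Q : ℝ} (hp : 0 ≤ p) (hQ : 0 ≤ Q)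
    (hm : |m - p| ≤ (B + 2) * Q) (h : x = y ∨ p ≤ Q) :
    ‖(p : ℂ) • x - (m : ℂ) • y‖ ≤ (B + 4) * Q := by
  rcases h with rfl | h
  · rw [← sub_smul, norm_smul, ← Complex.ofReal_sub, Complex.norm_real, norm_eq_abs,
      abs_sub_comm]
    nlinarith [mul_le_of_le_one_right (abs_nonneg (m - p)) hx]
  · refine (norm_sub_le _ _).trans ?_
    rw [norm_smul, norm_smul, Complex.norm_real, Complex.norm_real, norm_eq_abs, norm_eq_abs,
      abs_of_nonneg hp]
    have h1 := mul_le_of_le_one_right hp hx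
    have h2 := mul_le_of_le_one_right (abs_nonneg m) hy
    have h3 := abs_sub_abs_le_abs_sub m p
    rw [abs_of_nonneg hp] at h3
    linarith

theorem norm_column_sub_le {E : Type*} [NormedAddCommGroup E] [NormedSpace ℂ E] {x y z v : E}
    (hz : ‖z‖ ≤ 1) (hv : ‖v‖ ≤ 1) (p s f g m : ℝ) :
    ‖(p : ℂ) • x + (s : ℂ) • z - ((f : ℂ) • z + (g : ℂ) • v + (m : ℂ) • y)‖ ≤
      |f - s| + |g| + ‖(p : ℂ) • x - (m : ℂ) • y‖ := by
  have h : (p : ℂ) • x + (s : ℂ) • z - ((f : ℂ) • z + (g : ℂ) • v + (m : ℂ) • y) =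
      -(((f - s : ℝ) : ℂ) • z) - (g : ℂ) • v + ((p : ℂ) • x - (m : ℂ) • y) := by
    push_cast
    module
  rw [h]
  refine (norm_add_le _ _).trans (add_le_add_left ((norm_sub_le _ _).trans ?_) _)
  rw [norm_neg, norm_smul, norm_smul, Complex.norm_real, Complex.norm_real, norm_eq_abs,
    norm_eq_abs]
  exact add_le_add (mul_le_of_le_one_right (abs_nonneg _) hz)
    (mul_le_of_le_one_right (abs_nonneg _) hv)

theorem aC2_eq (q : ℝ) (N I J : ℤ) :
    aC2 q N I J = sqrtOneSub q (nn N + nn I) * sqrtOneSub q (nn N + nn J) := by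
  simp only [aC2, sqrtOneSub, nn]
  ring_nf

theorem aC1_eq (q : ℝ) (N I J : ℤ) : aC1 q N I J = q ^ (2 * nn N + nn I + nn J + 1) := by
  simp only [aC1, nn]
  ring_nf

/-- The conjugate `U(α̂* ⊕ α̂*)U*`. -/
def conjAlphaHatStar (A : Hsp →L[ℂ] Hsp) (U : Ksp ≃ₗᵢ[ℂ] Wsp) : Wsp →L[ℂ] Wsp :=
  U.toLinearIsometry.toContinuousLinearMap.comp
    ((dsum (ContinuousLinearMap.adjoint A)).comp U.symm.toLinearIsometry.toContinuousLinearMap)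

theorem conjAlphaHatStar_apply (A : Hsp →L[ℂ] Hsp) (U : Ksp ≃ₗᵢ[ℂ] Wsp) (v : Ksp) :
    conjAlphaHatStar A U (U v) = U (dsum (ContinuousLinearMap.adjoint A) v) := by
  simp [conjAlphaHatStar]

section Conjugate

variable {q : ℝ} {A : Hsp →L[ℂ] Hsp} (hA : IsAlphaHat q A) {U : Ksp ≃ₗᵢ[ℂ] Wsp}
  {N I J : ℤ}
include hA

theorem conjAlphaHatStar_eK1 (h : validH (N, I, J)) :
    conjAlphaHatStar A U (U (eK1 (eH N I J))) =
      (aC1 q (N - 1) (I + 1) (J + 1) : ℂ) • U (eK1 (eH (N - 1) (I + 1) (J + 1))) +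
        (aC2 q (N + 1) (I + 1) (J + 1) : ℂ) • U (eK1 (eH (N + 1) (I + 1) (J + 1))) := by
  rw [conjAlphaHatStar_apply, dsum_eK1, adjoint_eH hA h, eK1_smul_add_smul, map_add, map_smul,
    map_smul]

theorem conjAlphaHatStar_eK2 (h : validH (N, I, J)) :
    conjAlphaHatStar A U (U (eK2 (eH N I J))) =
      (aC1 q (N - 1) (I + 1) (J + 1) : ℂ) • U (eK2 (eH (N - 1) (I + 1) (J + 1))) +
        (aC2 q (N + 1) (I + 1) (J + 1) : ℂ) • U (eK2 (eH (N + 1) (I + 1) (J + 1))) := by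
  rw [conjAlphaHatStar_apply, dsum_eK2, adjoint_eH hA h, eK2_smul_add_smul, map_add, map_smul,
    map_smul]

end Conjugate

section Columns

variable {q : ℝ} (hq0 : 0 < q) (hq1 : q < 1) {A : Hsp →L[ℂ] Hsp} (hA : IsAlphaHat q A)
  {P : Wsp →L[ℂ] Wsp} (hP : IsPiAlphaStar q P) {U : Ksp ≃ₗᵢ[ℂ] Wsp} (hU : IsUmap U) {N I J : ℤ}
include hq0 hq1 hA hP hU

theorem norm_sub_apply_eU_le (h : validU (N, I, J)) :
    ‖(conjAlphaHatStar A U - P) (eU N I J)‖ ≤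
      ((1 - q)⁻¹ + 1 + (q⁻¹ - q) * (1 - q)⁻¹ ^ 2 + ((1 - q)⁻¹ + 4)) * q ^ (N : ℝ) := by
  obtain ⟨hN, hI, hIN, hJ, hJN⟩ := id h
  dsimp only at hN hI hIN hJ hJN
  have hn : 0 ≤ nn N := by unfold nn; positivity
  have hi : |nn I| ≤ nn N := by
    rw [nn, nn, abs_div, abs_two]
    gcongr
    exact_mod_cast hI
  have hj : |nn J| ≤ nn N + 1 / 2 := by
    have : |(J : ℝ)| ≤ N + 1 := by exact_mod_cast hJ
    rw [nn, nn, abs_div, abs_two]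
    linarith
  have hQ : q ^ (N : ℝ) = q ^ (2 * nn N) := by rw [nn]; ring_nf
  have hp := rpow_pos_of_pos hq0 (2 * nn N + nn I + nn J + 3 / 2)
  obtain ⟨x, b, hx, hb, hxy, hD⟩ : ∃ (x : Wsp) (b : ℝ), ‖x‖ ≤ 1 ∧
      (b = nn N + nn J + 3 / 2 ∨ nn N ≤ b ∧ nn N ≤ nn N + nn J + 3 / 2) ∧
      (x = eU (N - 1) (I + 1) (J + 1) ∨
        q ^ (2 * nn N + nn I + nn J + 3 / 2) ≤ q ^ (2 * nn N)) ∧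
      conjAlphaHatStar A U (eU N I J) =
        ((q ^ (2 * nn N + nn I + nn J + 3 / 2) : ℝ) : ℂ) • x +
        ((sqrtOneSub q (nn N + nn I + 1) * sqrtOneSub q b : ℝ) : ℂ) •
          eU (N + 1) (I + 1) (J + 1) := by
    rw [abs_le] at hI hJ
    by_cases hJ' : J = N + 1
    · subst hJ'
      have hv : validH (N, I, N) := by simp only [validH, abs_le]; omega
      have hv' : validH (N + 1, I + 1, N + 1) := by simp only [validH, abs_le]; omega
      have hz : U (eK1 (eH (N - 1) (I + 1) (N + 1))) = 0 := by
        rw [eH_of_not_valid (by simp only [validH, abs_le]; omega), eK1_zero, map_zero]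
      refine ⟨0, 2 * nn N + 1, by simp, .inr ⟨by linarith, ?_⟩, .inl ?_, ?_⟩
      · simp only [nn] at *; push_cast; linarith
      · rw [eU_of_not_valid (by simp only [validU, abs_le]; omega)]
      · rw [← hU.2.1 _ _ hv, conjAlphaHatStar_eK1 hA hv, hz, smul_zero, smul_zero,
          hU.2.1 _ _ hv', aC2_eq]
        simp only [nn]
        push_cast
        ring_nf
    · have hv : validH (N, I, J + 1) := by simp only [validH, abs_le]; omega
      have hv' : validH (N + 1, I + 1, J + 1 + 1) := by simp only [validH, abs_le]; omega
      refine ⟨U (eK2 (eH (N - 1) (I + 1) (J + 1 + 1))), nn N + nn J + 3 / 2, ?_, .inl rfl, ?_, ?_⟩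
      · rw [U.norm_map, norm_eK2]
        exact norm_eH_le _ _ _
      · by_cases hJ'' : J = N - 1
        · refine .inr (rpow_le_rpow_of_exponent_ge hq0 hq1.le ?_)
          have := (abs_le.1 hi).1
          have hJr : (J : ℝ) = N - 1 := by rw [hJ'']; push_cast; ring
          simp only [nn] at *
          linarith
        · left
          by_cases hv'' : validH (N - 1, I + 1, J + 1 + 1)
          · rw [hU.2.2 _ _ _ hv'', add_sub_cancel_right]
          · rw [eH_of_not_valid hv'', eK2_zero, map_zero, eU_of_not_valid]
            simp only [validH, validU, abs_le] at *
            omega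
      · have e := hU.2.2 _ _ _ hv
        rw [add_sub_cancel_right] at e
        rw [← e, conjAlphaHatStar_eK2 hA hv, hU.2.2 _ _ _ hv', aC2_eq, aC1_eq,
          add_sub_cancel_right]
        simp only [nn]
        push_cast
        ring_nf
  have hM : aM q (nn N) (nn I) (nn J) 1 0 = 0 := by simp [aM]
  rw [_root_.sub_apply, hP.1 _ _ _ h, hD, hM, Complex.ofReal_zero, zero_smul,
    add_zero, hQ, add_mul, add_mul]
  refine (norm_column_sub_le (norm_eU_le _ _ _) (norm_eD_le _ _ _) _ _ _ _ _).trans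
    (add_le_add_three (abs_aP_zero_zero_sub_le hq0 hq1 hn hb) ?_
      (norm_smul_sub_smul_le hx (norm_eU_le _ _ _) hp.le (rpow_pos_of_pos hq0 _).le
        (abs_aM_zero_zero_sub_le hq0 hq1 hn hi hj) hxy))
  rw [aP_one_zero hq0 hq1]
  exact abs_mul_mul_div_div_le hq0 hq1 (by linarith) (by linarith)
    (by linarith [(abs_le.1 hj).1])

theorem norm_sub_apply_eD_le (h : validD (N, I, J)) :
    ‖(conjAlphaHatStar A U - P) (eD N I J)‖ ≤
      ((1 - q)⁻¹ + 1 + (q⁻¹ - q) * (1 - q)⁻¹ ^ 2 + ((1 - q)⁻¹ + 4)) * q ^ (N : ℝ) := by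
  obtain ⟨hN, hI, hIN, hJ, hJN⟩ := id h
  dsimp only at hN hI hIN hJ hJN
  have hn : 1 / 2 ≤ nn N := by
    have : (1 : ℝ) ≤ N := by exact_mod_cast hN
    unfold nn
    linarith
  have hi : |nn I| ≤ nn N := by
    rw [nn, nn, abs_div, abs_two]
    gcongr
    exact_mod_cast hI
  have hj : |nn J| ≤ nn N - 1 / 2 := by
    have : |(J : ℝ)| ≤ N - 1 := by exact_mod_cast hJ
    rw [nn, nn, abs_div, abs_two]
    linarith
  have hQ : q ^ (N : ℝ) = q ^ (2 * nn N) := by rw [nn]; ring_nf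
  have hQ0 := rpow_pos_of_pos hq0 (2 * nn N)
  have hp := rpow_pos_of_pos hq0 (2 * nn N + nn I + nn J + 1 / 2)
  have hxy : U (eK1 (eH (N - 1) (I + 1) J)) = eD (N - 1) (I + 1) (J + 1) ∨
      q ^ (2 * nn N + nn I + nn J + 1 / 2) ≤ q ^ (2 * nn N) := by
    by_cases hJ' : J = N - 1
    · refine .inr (rpow_le_rpow_of_exponent_ge hq0 hq1.le ?_)
      have := (abs_le.1 hi).1
      have hJr : (J : ℝ) = N - 1 := by rw [hJ']; push_cast; ring
      simp only [nn] at *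
      linarith
    · left
      by_cases hv : validH (N - 1, I + 1, J)
      · exact hU.1 _ _ _ hv hJ'
      · rw [eH_of_not_valid hv, eK1_zero, map_zero, eD_of_not_valid]
        simp only [validH, validD, abs_le] at *
        omega
  have hD : conjAlphaHatStar A U (eD N I J) =
      ((q ^ (2 * nn N + nn I + nn J + 1 / 2) : ℝ) : ℂ) • U (eK1 (eH (N - 1) (I + 1) J)) +
      ((sqrtOneSub q (nn N + nn I + 1) * sqrtOneSub q (nn N + nn J + 1 / 2) : ℝ) : ℂ) •
        eD (N + 1) (I + 1) (J + 1) := by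
    rw [abs_le] at hI hJ
    have hv : validH (N, I, J - 1) := by simp only [validH, abs_le]; omega
    have hv' : validH (N + 1, I + 1, J) := by simp only [validH, abs_le]; omega
    have e := hU.1 _ _ _ hv (by omega)
    rw [sub_add_cancel] at e
    rw [← e, conjAlphaHatStar_eK1 hA hv, sub_add_cancel, hU.1 _ _ _ hv' (by omega), aC2_eq, aC1_eq]
    simp only [nn]
    push_cast
    ring_nf
  have hM : aP q (nn N) (nn I) (nn J) 0 1 = 0 := by simp [aP]
  rw [_root_.sub_apply, hP.2 _ _ _ h, hD, hM, Complex.ofReal_zero, zero_smul,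
    zero_add, hQ, add_mul, add_mul]
  refine (norm_column_sub_le (norm_eD_le _ _ _) (norm_eU_le _ _ _) _ _ _ _ _).trans
    (add_le_add_three ((abs_aP_one_one_sub_le hq0 hq1 (by linarith)).trans ?_) ?_
      (norm_smul_sub_smul_le ?_ (norm_eD_le _ _ _) hp.le hQ0.le
        (abs_aM_one_one_sub_le hq0 hq1 hn hi hj) hxy))
  · gcongr
    linarith
  · rw [aM_zero_one hq0 hq1, abs_neg]
    exact abs_mul_mul_div_div_le hq0 hq1 (by linarith) (by linarith)
      (by linarith [(abs_le.1 hi).1])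
  · rw [U.norm_map, norm_eK1]
    exact norm_eH_le _ _ _

theorem summable_norm_sub_single :
    Summable fun x : IdxW => ‖(conjAlphaHatStar A U - P) (lp.single 2 x 1)‖ := by
  refine .of_nonneg_of_le (fun _ => norm_nonneg _)
    (f := Sum.elim
      (fun x => ((1 - q)⁻¹ + 1 + (q⁻¹ - q) * (1 - q)⁻¹ ^ 2 + ((1 - q)⁻¹ + 4)) * q ^ (x.1.1 : ℝ))
      (fun x => ((1 - q)⁻¹ + 1 + (q⁻¹ - q) * (1 - q)⁻¹ ^ 2 + ((1 - q)⁻¹ + 4)) * q ^ (x.1.1 : ℝ)))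
    ?_ (.sum _ ?_ ?_)
  · rintro (⟨⟨N, I, J⟩, h⟩ | ⟨⟨N, I, J⟩, h⟩)
    · have := norm_sub_apply_eU_le hq0 hq1 hA hP hU h
      rwa [eU, dif_pos h] at this
    · have := norm_sub_apply_eD_le hq0 hq1 hA hP hU h
      rwa [eD, dif_pos h] at this
  · exact (summable_rpow_of_abs_le hq0 hq1 Subtype.val_injective fun x =>
      ⟨x.2.1, x.2.2.1, x.2.2.2.2.1⟩).mul_left _
  · exact (summable_rpow_of_abs_le hq0 hq1 Subtype.val_injective fun x =>
      ⟨by have := x.2.1; omega, x.2.2.1, by have := x.2.2.2.2.1; omega⟩).mul_left _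

end Columns

/-- The operator `U(α̂* ⊕ α̂*)U* − π'(α*)` on `𝓗` belongs to `K_q`, the
smallest norm-closed two-sided ideal of the bounded operators on `𝓗` containing the diagonal
operator `Γ_q`; equivalently, it belongs to every closed two-sided ideal containing `Γ_q`. -/
theorem conj_alphaHatStar_sub_piAlphaStar_mem_ideal (q : ℝ) (hq0 : 0 < q) (hq1 : q < 1)
    (A : Hsp →L[ℂ] Hsp) (hA : IsAlphaHat q A)
    (P : Wsp →L[ℂ] Wsp) (hP : IsPiAlphaStar q P)
    (U : Ksp ≃ₗᵢ[ℂ] Wsp) (hU : IsUmap U)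
    (G : Wsp →L[ℂ] Wsp) (hG : IsGammaQ q G)
    (I : TwoSidedIdeal (Wsp →L[ℂ] Wsp)) (hIclosed : IsClosed (I : Set (Wsp →L[ℂ] Wsp)))
    (hGI : G ∈ I) :
    (U.toLinearIsometry.toContinuousLinearMap.comp
        ((dsum (ContinuousLinearMap.adjoint A)).comp
          U.symm.toLinearIsometry.toContinuousLinearMap))
      - P ∈ I := by
  refine I.mem_of_summable_norm_single hIclosed hGI
    (g := Sum.elim (fun x => ((q ^ ((x.1.1 : ℝ) / 2) : ℝ) : ℂ))
      (fun x => ((q ^ ((x.1.1 : ℝ) / 2) : ℝ) : ℂ))) ?_ ?_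
    (summable_norm_sub_single hq0 hq1 hA hP hU)
  · rintro (x | x) <;> exact Complex.ofReal_ne_zero.2 (rpow_pos_of_pos hq0 _).ne'
  · rintro (⟨⟨N, I, J⟩, h⟩ | ⟨⟨N, I, J⟩, h⟩)
    · have := hG.1 N I J h
      rwa [eU, dif_pos h] at this
    · have := hG.2 N I J h
      rwa [eD, dif_pos h] at this
end
end

section
/- Each of the commutators [D, π'(α*)] and [D, π'(β)], defined on the algebraic span of the basis vectors of 𝓗, extends to a bounded operator on 𝓗. -/
noncomputable section

open Real

/-- the eigenvalue of `D` on `u^n_{ij}`: `2n+1` (here `n = N/2`) -/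
def muU (N : ℤ) : ℝ := (N : ℝ) + 1

/-- the eigenvalue of `D` on `d^n_{ij}`: `-2n` (here `n = N/2`) -/
def muD (N : ℤ) : ℝ := -(N : ℝ)

/-- A uniformly bounded family of pairwise orthogonal vectors is the image of the standard basis of
`ℓ²` under a bounded operator. -/
theorem exists_clm_of_pairwise_orthogonal {ι E : Type*} [DecidableEq ι] [NormedAddCommGroup E]
    [InnerProductSpace ℂ E] [CompleteSpace E] (w : ι → E)
    (hw : Pairwise fun x y => inner ℂ (w x) (w y) = 0) (C : ℝ) (hC : ∀ x, ‖w x‖ ≤ C) :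
    ∃ T : lp (fun _ : ι => ℂ) 2 →L[ℂ] E, ∀ x, T (lp.single 2 x 1) = w x := by
  let W : ι → Submodule ℂ E := fun x => Submodule.span ℂ {w x}
  have hW : OrthogonalFamily ℂ (fun x => W x) fun x => (W x).subtypeₗᵢ := by
    rintro x y hxy ⟨a, ha⟩ ⟨b, hb⟩
    obtain ⟨r, rfl⟩ := Submodule.mem_span_singleton.1 ha
    obtain ⟨s, rfl⟩ := Submodule.mem_span_singleton.1 hb
    simp [inner_smul_left, inner_smul_right, hw hxy]
  let w' : ∀ x, W x := fun x => ⟨w x, Submodule.mem_span_singleton_self _⟩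
  have hle (v : ι → ℂ) (x : ι) : ‖v x • w' x‖ ≤ ‖((C : ℂ) • v) x‖ := by
    rw [norm_smul, Pi.smul_apply, norm_smul, mul_comm, Complex.norm_real]
    exact mul_le_mul_of_nonneg_right ((hC x).trans (le_abs_self C)) (norm_nonneg _)
  let L : lp (fun _ : ι => ℂ) 2 →ₗ[ℂ] lp (fun x => W x) 2 :=
    { toFun := fun v => ⟨fun x => v x • w' x, ((lp.memℓp v).const_smul (C : ℂ)).mono' (hle v)⟩
      map_add' := fun u v => Subtype.ext (funext fun x => add_smul (u x) (v x) (w' x))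
      map_smul' := fun c v => by ext x; simp [mul_smul] }
  have hL (v) : ‖L v‖ ≤ |C| * ‖v‖ := by
    have h : ‖L v‖ ≤ ‖(C : ℂ) • v‖ := lp.norm_mono two_ne_zero (hle v)
    rwa [norm_smul, Complex.norm_real] at h
  refine ⟨hW.linearIsometry.toContinuousLinearMap.comp (L.mkContinuous |C| hL), fun x => ?_⟩
  have hx : L (lp.single 2 x 1) = lp.single 2 x (w' x) := by
    ext y
    by_cases h : y = x
    · subst h; simp [L]
    · simp [L, lp.single_apply, Pi.single_eq_of_ne h]
  simp [hx, w']

theorem inner_single_single_of_ne {x y : IdxW} (h : x ≠ y) :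
    inner ℂ (lp.single 2 x (1 : ℂ) : Wsp) (lp.single 2 y (1 : ℂ)) = 0 := by
  rw [lp.inner_single_left, lp.single_apply_ne _ _ _ h, inner_zero_right]

theorem inner_eU_eU {N I J N' I' J' : ℤ} (h : (N, I, J) ≠ (N', I', J')) :
    inner ℂ (eU N I J) (eU N' I' J') = 0 := by
  unfold eU
  split_ifs
  · exact inner_single_single_of_ne fun e => h (congrArg Subtype.val (Sum.inl.inj e))
  all_goals simp

theorem inner_eD_eD {N I J N' I' J' : ℤ} (h : (N, I, J) ≠ (N', I', J')) :
    inner ℂ (eD N I J) (eD N' I' J') = 0 := by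
  unfold eD
  split_ifs
  · exact inner_single_single_of_ne fun e => h (congrArg Subtype.val (Sum.inr.inj e))
  all_goals simp

theorem inner_eU_eD (N I J N' I' J' : ℤ) : inner ℂ (eU N I J) (eD N' I' J') = 0 := by
  unfold eU eD
  split_ifs
  · exact inner_single_single_of_ne Sum.inl_ne_inr
  all_goals simp

theorem inner_eD_eU (N I J N' I' J' : ℤ) : inner ℂ (eD N I J) (eU N' I' J') = 0 :=
  inner_eq_zero_symm.1 (inner_eU_eD N' I' J' N I J)

theorem shift_ne {N I J N' I' J' : ℤ} (h : (N, I, J) ≠ (N', I', J')) (a b c : ℤ) :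
    (N + a, I + b, J + c) ≠ (N' + a, I' + b, J' + c) := by
  simpa using h

/-- Bounded coefficients define a bounded weighted shift of the basis of `𝓗`. -/
theorem exists_clm_weighted (gU gD : ℤ → ℤ → ℤ → Wsp)
    (hgU : ∀ N I J, ‖gU N I J‖ ≤ 1) (hgD : ∀ N I J, ‖gD N I J‖ ≤ 1)
    (hUU : ∀ N I J N' I' J', (N, I, J) ≠ (N', I', J') → inner ℂ (gU N I J) (gU N' I' J') = 0)
    (hDD : ∀ N I J N' I' J', (N, I, J) ≠ (N', I', J') → inner ℂ (gD N I J) (gD N' I' J') = 0)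
    (hUD : ∀ N I J N' I' J', inner ℂ (gU N I J) (gD N' I' J') = 0)
    (cU cD : ℤ → ℤ → ℤ → ℝ) (C : ℝ)
    (hU : ∀ N I J, validU (N, I, J) → |cU N I J| ≤ C)
    (hD : ∀ N I J, validD (N, I, J) → |cD N I J| ≤ C) :
    ∃ T : Wsp →L[ℂ] Wsp,
      (∀ N I J, validU (N, I, J) → T (eU N I J) = (cU N I J : ℂ) • gU N I J) ∧
      (∀ N I J, validD (N, I, J) → T (eD N I J) = (cD N I J : ℂ) • gD N I J) := by
  have hsmul {r : ℝ} {v : Wsp} (hr : |r| ≤ C) (hv : ‖v‖ ≤ 1) : ‖(r : ℂ) • v‖ ≤ C := by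
    rw [norm_smul, Complex.norm_real]
    exact (mul_le_of_le_one_right (norm_nonneg r) hv).trans hr
  obtain ⟨T, hT⟩ := exists_clm_of_pairwise_orthogonal (ι := IdxW) (E := Wsp)
    (Sum.elim (fun x => (cU x.1.1 x.1.2.1 x.1.2.2 : ℂ) • gU x.1.1 x.1.2.1 x.1.2.2)
      (fun x => (cD x.1.1 x.1.2.1 x.1.2.2 : ℂ) • gD x.1.1 x.1.2.1 x.1.2.2))
    (by
      rintro (⟨x, hx⟩ | ⟨x, hx⟩) (⟨y, hy⟩ | ⟨y, hy⟩) hxy <;>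
        simp only [Sum.elim_inl, Sum.elim_inr, inner_smul_left, inner_smul_right]
      · rw [hUU _ _ _ _ _ _ fun e => hxy (by congr)]; simp
      · rw [hUD]; simp
      · rw [inner_eq_zero_symm.1 (hUD _ _ _ _ _ _)]; simp
      · rw [hDD _ _ _ _ _ _ fun e => hxy (by congr)]; simp)
    C
    (by
      rintro (⟨x, hx⟩ | ⟨x, hx⟩)
      · exact hsmul (hU _ _ _ hx) (hgU _ _ _)
      · exact hsmul (hD _ _ _ hx) (hgD _ _ _))
  refine ⟨T, fun N I J h => ?_, fun N I J h => ?_⟩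
  · rw [eU, dif_pos h, hT]; rfl
  · rw [eD, dif_pos h, hT]; rfl

/-- A nearest-neighbour operator in the index `n`, given on the basis by matrices with bounded
entries, extends to a bounded operator. -/
theorem exists_clm_of_bounded_entries (s t : ℤ) (P M : ℤ → ℤ → ℤ → Fin 2 → Fin 2 → ℝ) (C : ℝ)
    (hU : ∀ N I J, validU (N, I, J) → ∀ k, |P N I J k 0| ≤ C ∧ |M N I J k 0| ≤ C)
    (hD : ∀ N I J, validD (N, I, J) → ∀ k, |P N I J k 1| ≤ C ∧ |M N I J k 1| ≤ C) :
    ∃ T : Wsp →L[ℂ] Wsp,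
      (∀ N I J, validU (N, I, J) → T (eU N I J) =
        (P N I J 0 0 : ℂ) • eU (N + 1) (I + s) (J + t)
          + (P N I J 1 0 : ℂ) • eD (N + 1) (I + s) (J + t)
          + (M N I J 0 0 : ℂ) • eU (N + -1) (I + s) (J + t)
          + (M N I J 1 0 : ℂ) • eD (N + -1) (I + s) (J + t)) ∧
      (∀ N I J, validD (N, I, J) → T (eD N I J) =
        (P N I J 0 1 : ℂ) • eU (N + 1) (I + s) (J + t)
          + (P N I J 1 1 : ℂ) • eD (N + 1) (I + s) (J + t)
          + (M N I J 0 1 : ℂ) • eU (N + -1) (I + s) (J + t)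
          + (M N I J 1 1 : ℂ) • eD (N + -1) (I + s) (J + t)) := by
  have diag (r : ℤ) := exists_clm_weighted (fun N I J => eU (N + r) (I + s) (J + t))
    (fun N I J => eD (N + r) (I + s) (J + t)) (fun _ _ _ => norm_eU_le _ _ _)
    (fun _ _ _ => norm_eD_le _ _ _) (fun _ _ _ _ _ _ h => inner_eU_eU (shift_ne h r s t))
    (fun _ _ _ _ _ _ h => inner_eD_eD (shift_ne h r s t))
    (fun _ _ _ _ _ _ => inner_eU_eD _ _ _ _ _ _)
  have anti (r : ℤ) := exists_clm_weighted (fun N I J => eD (N + r) (I + s) (J + t))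
    (fun N I J => eU (N + r) (I + s) (J + t)) (fun _ _ _ => norm_eD_le _ _ _)
    (fun _ _ _ => norm_eU_le _ _ _) (fun _ _ _ _ _ _ h => inner_eD_eD (shift_ne h r s t))
    (fun _ _ _ _ _ _ h => inner_eU_eU (shift_ne h r s t))
    (fun _ _ _ _ _ _ => inner_eD_eU _ _ _ _ _ _)
  obtain ⟨T₁, hU₁, hD₁⟩ := diag 1 (P · · · 0 0) (P · · · 1 1) C
    (fun N I J h => (hU N I J h 0).1) (fun N I J h => (hD N I J h 1).1)
  obtain ⟨T₂, hU₂, hD₂⟩ := anti 1 (P · · · 1 0) (P · · · 0 1) C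
    (fun N I J h => (hU N I J h 1).1) (fun N I J h => (hD N I J h 0).1)
  obtain ⟨T₃, hU₃, hD₃⟩ := diag (-1) (M · · · 0 0) (M · · · 1 1) C
    (fun N I J h => (hU N I J h 0).2) (fun N I J h => (hD N I J h 1).2)
  obtain ⟨T₄, hU₄, hD₄⟩ := anti (-1) (M · · · 1 0) (M · · · 0 1) C
    (fun N I J h => (hU N I J h 1).2) (fun N I J h => (hD N I J h 0).2)
  refine ⟨T₁ + T₂ + T₃ + T₄, fun N I J h => ?_, fun N I J h => ?_⟩
  · simp only [add_apply, hU₁ N I J h, hU₂ N I J h, hU₃ N I J h, hU₄ N I J h]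
  · simp only [add_apply, hD₁ N I J h, hD₂ N I J h, hD₃ N I J h, hD₄ N I J h]
    abel

section Estimates

variable {q : ℝ}

theorem qnum_nonneg (hq0 : 0 < q) (hq1 : q < 1) {m : ℝ} (hm : 0 ≤ m) : 0 ≤ qnum q m := by
  have h1 : q - q⁻¹ ≤ 0 := by linarith [(one_lt_inv₀ hq0).2 hq1]
  have h2 : q ^ m ≤ q ^ (-m) := rpow_le_rpow_of_exponent_ge hq0 hq1.le (by linarith)
  exact div_nonneg_of_nonpos (by linarith) h1

theorem sqrt_qnum_le (hq0 : 0 < q) (hq1 : q < 1) (m : ℝ) :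
    √(qnum q m) ≤ √((q⁻¹ - q)⁻¹) * q ^ (-m / 2) := by
  have h1 : 0 < q⁻¹ - q := by linarith [(one_lt_inv₀ hq0).2 hq1]
  have h2 : qnum q m ≤ (q⁻¹ - q)⁻¹ * (q ^ (-m / 2)) ^ 2 := by
    rw [← rpow_mul_natCast hq0.le, qnum, ← neg_sub q⁻¹ q, div_neg, ← neg_div, div_eq_inv_mul]
    gcongr
    have := rpow_pos_of_pos hq0 m
    push_cast
    rw [div_mul_cancel₀ _ two_ne_zero]
    linarith
  calc √(qnum q m) ≤ √((q⁻¹ - q)⁻¹ * (q ^ (-m / 2)) ^ 2) := sqrt_le_sqrt h2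
    _ = √((q⁻¹ - q)⁻¹) * q ^ (-m / 2) := by
      rw [sqrt_mul (by positivity), sqrt_sq (by positivity)]

theorem inv_qnum_le (hq0 : 0 < q) (hq1 : q < 1) {m : ℝ} (hm : 1 ≤ m) :
    (qnum q m)⁻¹ ≤ q ^ (m - 1) := by
  have h1 : 0 < q⁻¹ - q := by linarith [(one_lt_inv₀ hq0).2 hq1]
  have h2 : q ^ (-(m - 1)) ≤ qnum q m := by
    rw [qnum, ← neg_sub q⁻¹ q, div_neg, ← neg_div, le_div_iff₀ h1]
    have e1 : q ^ (-(m - 1)) * q⁻¹ = q ^ (-m) * 1 := by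
      rw [← rpow_neg_one, ← rpow_add hq0, mul_one]; ring_nf
    have e2 : q ^ (-(m - 1)) * q = q ^ (2 - m) := by
      nth_rewrite 2 [← rpow_one q]
      rw [← rpow_add hq0]; ring_nf
    have e3 : q ^ m ≤ q ^ (2 - m) := rpow_le_rpow_of_exponent_ge hq0 hq1.le (by linarith)
    linarith [mul_sub (q ^ (-(m - 1))) q⁻¹ q]
  rw [← neg_neg (m - 1), rpow_neg hq0.le]
  exact inv_anti₀ (by positivity) h2

theorem abs_entry_le (hq0 : 0 < q) (hq1 : q < 1) (x m₁ y m₂ : ℝ) {r : ℝ} (hr : 1 ≤ r) :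
    |q ^ x * √(qnum q m₁) * (q ^ y * √(qnum q m₂) / qnum q r)| ≤
      (q⁻¹ - q)⁻¹ * q ^ (x - m₁ / 2 + y - m₂ / 2 + r - 1) := by
  have h1 : 0 < q⁻¹ - q := by linarith [(one_lt_inv₀ hq0).2 hq1]
  have h0 := qnum_nonneg hq0 hq1 (zero_le_one.trans hr)
  rw [abs_of_nonneg (by positivity), div_eq_mul_inv]
  calc _ ≤ q ^ x * (√((q⁻¹ - q)⁻¹) * q ^ (-m₁ / 2)) *
        (q ^ y * (√((q⁻¹ - q)⁻¹) * q ^ (-m₂ / 2)) * q ^ (r - 1)) := by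
        gcongr
        · exact sqrt_qnum_le hq0 hq1 m₁
        · exact sqrt_qnum_le hq0 hq1 m₂
        · exact inv_qnum_le hq0 hq1 hr
    _ = (√((q⁻¹ - q)⁻¹) * √((q⁻¹ - q)⁻¹)) *
        (q ^ x * q ^ (-m₁ / 2) * q ^ y * q ^ (-m₂ / 2) * q ^ (r - 1)) := by ring
    _ = _ := by
        rw [mul_self_sqrt (by positivity)]
        simp only [← rpow_add hq0]
        ring_nf

theorem abs_entry_le_of_mul (hq0 : 0 < q) (hq1 : q < 1) (x m₁ y m₂ : ℝ) {r s : ℝ} (hr : 1 ≤ r)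
    (hs : 1 ≤ s) :
    |q ^ x * √(qnum q m₁) * (q ^ y * √(qnum q m₂) / (qnum q r * qnum q s))| ≤
      (q⁻¹ - q)⁻¹ * q ^ (x - m₁ / 2 + y - m₂ / 2 + r + s - 2) := by
  have h0 := qnum_nonneg hq0 hq1 (zero_le_one.trans hs)
  rw [← div_div, ← mul_div_assoc, abs_div, abs_of_nonneg h0, div_eq_mul_inv]
  calc _ ≤ (q⁻¹ - q)⁻¹ * q ^ (x - m₁ / 2 + y - m₂ / 2 + r - 1) * q ^ (s - 1) :=
        mul_le_mul (abs_entry_le hq0 hq1 x m₁ y m₂ hr) (inv_qnum_le hq0 hq1 hs)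
          (by positivity) ((abs_nonneg _).trans (abs_entry_le hq0 hq1 x m₁ y m₂ hr))
    _ = _ := by
        rw [mul_assoc, ← rpow_add hq0]
        ring_nf

theorem add_one_mul_rpow_le (hq0 : 0 < q) (hq1 : q < 1) {x : ℝ} (hx : 0 ≤ x) :
    (x + 1) * q ^ x ≤ 1 + (-log q)⁻¹ := by
  have hc : 0 < -log q := by linarith [log_neg hq0 hq1]
  have h1 : q ^ x ≤ 1 := rpow_le_one hq0.le hq1.le hx
  have h2 : x * q ^ x ≤ (-log q)⁻¹ := by
    rw [← one_div, le_div_iff₀ hc, rpow_def_of_pos hq0]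
    calc x * exp (log q * x) * -log q = (x * -log q) * exp (log q * x) := by ring
      _ ≤ exp (x * -log q) * exp (log q * x) := by
        gcongr
        linarith [add_one_le_exp (x * -log q)]
      _ = 1 := by
        rw [← exp_add, mul_comm x, neg_mul, neg_add_cancel, exp_zero]
  linarith

/-- A bound, depending only on `q`, for the matrix entries of the commutators. -/
def commBound (q : ℝ) : ℝ := 2 * ((q⁻¹ - q)⁻¹ * q ^ (-3 : ℝ)) * (1 + (-log q)⁻¹)

theorem abs_mul_le_commBound_of_eq_one (hq0 : 0 < q) (hq1 : q < 1) {c v e : ℝ} (hc : |c| = 1)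
    (hv : |v| ≤ (q⁻¹ - q)⁻¹ * q ^ e) (he : -3 ≤ e) : |c * v| ≤ commBound q := by
  have h1 : 0 < q⁻¹ - q := by linarith [(one_lt_inv₀ hq0).2 hq1]
  have h2 : 0 < -log q := by linarith [log_neg hq0 hq1]
  rw [abs_mul, hc, one_mul]
  calc |v| ≤ (q⁻¹ - q)⁻¹ * q ^ (-3 : ℝ) :=
        hv.trans (by gcongr ?_ * ?_; exact rpow_le_rpow_of_exponent_ge hq0 hq1.le he)
    _ ≤ 2 * ((q⁻¹ - q)⁻¹ * q ^ (-3 : ℝ)) := le_mul_of_one_le_left (by positivity) one_le_two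
    _ ≤ commBound q := le_mul_of_one_le_right (by positivity) (by linarith [inv_pos.2 h2])

theorem abs_mul_le_commBound_of_le (hq0 : 0 < q) (hq1 : q < 1) {c v e x : ℝ} (hx : 0 ≤ x)
    (hc : |c| ≤ 2 * (x + 1)) (hv : |v| ≤ (q⁻¹ - q)⁻¹ * q ^ e) (he : x - 3 ≤ e) :
    |c * v| ≤ commBound q := by
  have h1 : 0 < q⁻¹ - q := by linarith [(one_lt_inv₀ hq0).2 hq1]
  rw [abs_mul]
  calc |c| * |v| ≤ (2 * (x + 1)) * ((q⁻¹ - q)⁻¹ * q ^ (x + -3)) := by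
        gcongr
        exact hv.trans (by gcongr ?_ * ?_; exact rpow_le_rpow_of_exponent_ge hq0 hq1.le he)
    _ = 2 * ((q⁻¹ - q)⁻¹ * q ^ (-3 : ℝ)) * ((x + 1) * q ^ x) := by
        rw [rpow_add hq0]; ring
    _ ≤ commBound q := by
        unfold commBound
        gcongr
        exact add_one_mul_rpow_le hq0 hq1 hx

theorem commBound_nonneg (hq0 : 0 < q) (hq1 : q < 1) : 0 ≤ commBound q := by
  have h1 : 0 < q⁻¹ - q := by linarith [(one_lt_inv₀ hq0).2 hq1]
  have h2 : 0 < -log q := by linarith [log_neg hq0 hq1]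
  unfold commBound
  positivity

end Estimates

/-- The eigenvalues of `D` on the `u` and `d` vectors, as one family. -/
def mu : Fin 2 → ℤ → ℝ := ![muU, muD]

theorem abs_comm_aP_le {q : ℝ} (hq0 : 0 < q) (hq1 : q < 1) {N I J : ℤ} (hN : (0 : ℝ) ≤ N)
    (hJ : -(N + 1 : ℝ) ≤ J) (k l : Fin 2) :
    |(mu k (N + 1) - mu l N) * aP q (nn N) (nn I) (nn J) k l| ≤ commBound q := by
  have hr : 1 ≤ 2 * nn N + 1 := by unfold nn; linarith
  have hs : 1 ≤ 2 * nn N + 2 := by linarith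
  revert k l
  simp only [Fin.forall_fin_two]
  refine ⟨⟨?_, ?_⟩, ?_, ?_⟩
  · have h := abs_entry_le hq0 hq1 ((nn I + nn J - 1 / 2) / 2)
      (nn N + nn I + 1) (-nn N - 1 / 2) (nn N + nn J + 3 / 2) hs
    exact abs_mul_le_commBound_of_eq_one hq0 hq1 (by simp [mu, muU, muD]) h (by unfold nn; linarith)
  · simpa [aP] using commBound_nonneg hq0 hq1
  · have h := abs_entry_le_of_mul hq0 hq1 ((nn I + nn J - 1 / 2) / 2)
      (nn N + nn I + 1) (1 / 2) (nn N - nn J + 1 / 2) hr hs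
    refine abs_mul_le_commBound_of_le hq0 hq1 hN ?_ h ?_
    · simp only [mu, muU, muD, Matrix.cons_val]
      push_cast
      exact abs_le.2 ⟨by linarith, by linarith⟩
    · unfold nn; linarith
  · have h := abs_entry_le hq0 hq1 ((nn I + nn J - 1 / 2) / 2)
      (nn N + nn I + 1) (-nn N) (nn N + nn J + 1 / 2) hr
    exact abs_mul_le_commBound_of_eq_one hq0 hq1 (by simp [mu, muU, muD]) h (by unfold nn; linarith)

theorem abs_comm_aM_le {q : ℝ} (hq0 : 0 < q) (hq1 : q < 1) {N I J : ℤ} (hN : (0 : ℝ) ≤ N)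
    (hI : -(N : ℝ) ≤ I) (hJ : -(N + 1 : ℝ) ≤ J) (k l : Fin 2) (hl : l = 1 → (1 : ℝ) ≤ N) :
    |(mu k (N + -1) - mu l N) * aM q (nn N) (nn I) (nn J) k l| ≤ commBound q := by
  have hr : 1 ≤ 2 * nn N + 1 := by unfold nn; linarith
  have hz (hl : True → (1 : ℝ) ≤ N) : 1 ≤ 2 * nn N := by
    unfold nn; linarith [hl trivial]
  revert k l
  simp only [Fin.forall_fin_two]
  refine ⟨⟨?_, ?_⟩, ?_, ?_⟩
  · intro _
    have h := abs_entry_le hq0 hq1 ((nn I + nn J - 1 / 2) / 2)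
      (nn N - nn I) (nn N + 1) (nn N - nn J + 1 / 2) hr
    exact abs_mul_le_commBound_of_eq_one hq0 hq1 (by simp [mu, muU, muD]) h (by unfold nn; linarith)
  · intro hl
    have h := abs_entry_le_of_mul hq0 hq1 ((nn I + nn J - 1 / 2) / 2)
      (nn N - nn I) (1 / 2) (nn N + nn J + 1 / 2) (hz hl) hr
    rw [← abs_neg, ← mul_neg] at h
    refine abs_mul_le_commBound_of_le hq0 hq1 hN ?_ h ?_
    · simp only [mu, muU, muD, Matrix.cons_val]
      push_cast
      exact abs_le.2 ⟨by linarith, by linarith⟩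
    · unfold nn; linarith
  · intro _
    simpa [aM] using commBound_nonneg hq0 hq1
  · intro hl
    have h := abs_entry_le hq0 hq1 ((nn I + nn J - 1 / 2) / 2)
      (nn N - nn I) (nn N + 1 / 2) (nn N - nn J - 1 / 2) (hz hl)
    exact abs_mul_le_commBound_of_eq_one hq0 hq1 (by simp [mu, muU, muD]) h (by unfold nn; linarith)

theorem abs_comm_bP_le {q : ℝ} (hq0 : 0 < q) (hq1 : q < 1) {N I J : ℤ} (hN : (0 : ℝ) ≤ N)
    (hJ : -(N + 1 : ℝ) ≤ J) (k l : Fin 2) :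
    |(mu k (N + 1) - mu l N) * bP q (nn N) (nn I) (nn J) k l| ≤ commBound q := by
  have hr : 1 ≤ 2 * nn N + 1 := by unfold nn; linarith
  have hs : 1 ≤ 2 * nn N + 2 := by linarith
  revert k l
  simp only [Fin.forall_fin_two]
  refine ⟨⟨?_, ?_⟩, ?_, ?_⟩
  · have h := abs_entry_le hq0 hq1 ((nn I + nn J - 1 / 2) / 2)
      (nn N + nn I + 1) 0 (nn N - nn J + 3 / 2) hs
    rw [rpow_zero, one_mul] at h
    exact abs_mul_le_commBound_of_eq_one hq0 hq1 (by simp [mu, muU, muD]) h (by unfold nn; linarith)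
  · simpa [bP] using commBound_nonneg hq0 hq1
  · have h := abs_entry_le_of_mul hq0 hq1 ((nn I + nn J - 1 / 2) / 2)
      (nn N + nn I + 1) (-nn N - 1) (nn N + nn J + 1 / 2) hr hs
    rw [← abs_neg, ← mul_neg] at h
    refine abs_mul_le_commBound_of_le hq0 hq1 hN ?_ h ?_
    · simp only [mu, muU, muD, Matrix.cons_val]
      push_cast
      exact abs_le.2 ⟨by linarith, by linarith⟩
    · unfold nn; linarith
  · have h := abs_entry_le hq0 hq1 ((nn I + nn J - 1 / 2) / 2)
      (nn N + nn I + 1) (-1 / 2) (nn N - nn J + 1 / 2) hr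
    exact abs_mul_le_commBound_of_eq_one hq0 hq1 (by simp [mu, muU, muD]) h (by unfold nn; linarith)

theorem abs_comm_bM_le {q : ℝ} (hq0 : 0 < q) (hq1 : q < 1) {N I J : ℤ} (hN : (0 : ℝ) ≤ N)
    (hI : -(N : ℝ) ≤ I) (hJ : -(N + 1 : ℝ) ≤ J) (k l : Fin 2) (hl : l = 1 → (1 : ℝ) ≤ N) :
    |(mu k (N + -1) - mu l N) * bM q (nn N) (nn I) (nn J) k l| ≤ commBound q := by
  have hr : 1 ≤ 2 * nn N + 1 := by unfold nn; linarith
  have hz (hl : True → (1 : ℝ) ≤ N) : 1 ≤ 2 * nn N := by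
    unfold nn; linarith [hl trivial]
  revert k l
  simp only [Fin.forall_fin_two]
  refine ⟨⟨?_, ?_⟩, ?_, ?_⟩
  · intro _
    have h := abs_entry_le hq0 hq1 ((nn I + nn J - 1 / 2) / 2)
      (nn N - nn I) (-1 / 2) (nn N + nn J + 1 / 2) hr
    rw [← abs_neg, ← mul_neg] at h
    exact abs_mul_le_commBound_of_eq_one hq0 hq1 (by simp [mu, muU, muD]) h (by unfold nn; linarith)
  · intro hl
    have h := abs_entry_le_of_mul hq0 hq1 ((nn I + nn J - 1 / 2) / 2)
      (nn N - nn I) (nn N) (nn N - nn J + 1 / 2) (hz hl) hr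
    rw [← abs_neg, ← mul_neg] at h
    refine abs_mul_le_commBound_of_le hq0 hq1 hN ?_ h ?_
    · simp only [mu, muU, muD, Matrix.cons_val]
      push_cast
      exact abs_le.2 ⟨by linarith, by linarith⟩
    · unfold nn; linarith
  · intro _
    simpa [bM] using commBound_nonneg hq0 hq1
  · intro hl
    have h := abs_entry_le hq0 hq1 ((nn I + nn J - 1 / 2) / 2)
      (nn N - nn I) 0 (nn N + nn J - 1 / 2) (hz hl)
    rw [← abs_neg, ← mul_neg] at h
    rw [rpow_zero, one_mul] at h
    exact abs_mul_le_commBound_of_eq_one hq0 hq1 (by simp [mu, muU, muD]) h (by unfold nn; linarith)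

theorem validU.bounds {N I J : ℤ} (h : validU (N, I, J)) :
    (0 : ℝ) ≤ N ∧ -(N : ℝ) ≤ I ∧ -(N + 1 : ℝ) ≤ J := by
  obtain ⟨h1, h2, -, h3, -⟩ := h
  exact ⟨by exact_mod_cast h1, by exact_mod_cast (abs_le.1 h2).1, by exact_mod_cast (abs_le.1 h3).1⟩

theorem validD.bounds {N I J : ℤ} (h : validD (N, I, J)) :
    (1 : ℝ) ≤ N ∧ -(N : ℝ) ≤ I ∧ -(N + 1 : ℝ) ≤ J := by
  obtain ⟨h1, h2, -, h3, -⟩ := h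
  have h4 : -(N + 1) ≤ J := by linarith [(abs_le.1 h3).1]
  exact ⟨by exact_mod_cast h1, by exact_mod_cast (abs_le.1 h2).1, by exact_mod_cast h4⟩

/-- Each of the commutators `[D, π'(α*)]` and `[D, π'(β)]`, defined on the
algebraic span of the basis vectors of `𝓗`, extends to a bounded operator on `𝓗`. -/
theorem commutators_D_pi_bounded (q : ℝ) (hq0 : 0 < q) (hq1 : q < 1) :
    ∃ T₁ T₂ : Wsp →L[ℂ] Wsp,
      (∀ N I J : ℤ, validU (N, I, J) →
        T₁ (eU N I J) =
            (((muU (N+1) - muU N) * aP q (nn N) (nn I) (nn J) 0 0 : ℝ) : ℂ) •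
                eU (N+1) (I+1) (J+1)
              + (((muD (N+1) - muU N) * aP q (nn N) (nn I) (nn J) 1 0 : ℝ) : ℂ) •
                eD (N+1) (I+1) (J+1)
              + (((muU (N-1) - muU N) * aM q (nn N) (nn I) (nn J) 0 0 : ℝ) : ℂ) •
                eU (N-1) (I+1) (J+1)
              + (((muD (N-1) - muU N) * aM q (nn N) (nn I) (nn J) 1 0 : ℝ) : ℂ) •
                eD (N-1) (I+1) (J+1) ∧
        T₂ (eU N I J) =
            ((-((muU (N+1) - muU N) * bP q (nn N) (nn I) (nn J) 0 0) : ℝ) : ℂ) •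
                eU (N+1) (I+1) (J-1)
              + ((-((muD (N+1) - muU N) * bP q (nn N) (nn I) (nn J) 1 0) : ℝ) : ℂ) •
                eD (N+1) (I+1) (J-1)
              + ((-((muU (N-1) - muU N) * bM q (nn N) (nn I) (nn J) 0 0) : ℝ) : ℂ) •
                eU (N-1) (I+1) (J-1)
              + ((-((muD (N-1) - muU N) * bM q (nn N) (nn I) (nn J) 1 0) : ℝ) : ℂ) •
                eD (N-1) (I+1) (J-1)) ∧
      (∀ N I J : ℤ, validD (N, I, J) →
        T₁ (eD N I J) =
            (((muU (N+1) - muD N) * aP q (nn N) (nn I) (nn J) 0 1 : ℝ) : ℂ) •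
                eU (N+1) (I+1) (J+1)
              + (((muD (N+1) - muD N) * aP q (nn N) (nn I) (nn J) 1 1 : ℝ) : ℂ) •
                eD (N+1) (I+1) (J+1)
              + (((muU (N-1) - muD N) * aM q (nn N) (nn I) (nn J) 0 1 : ℝ) : ℂ) •
                eU (N-1) (I+1) (J+1)
              + (((muD (N-1) - muD N) * aM q (nn N) (nn I) (nn J) 1 1 : ℝ) : ℂ) •
                eD (N-1) (I+1) (J+1) ∧
        T₂ (eD N I J) =
            ((-((muU (N+1) - muD N) * bP q (nn N) (nn I) (nn J) 0 1) : ℝ) : ℂ) •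
                eU (N+1) (I+1) (J-1)
              + ((-((muD (N+1) - muD N) * bP q (nn N) (nn I) (nn J) 1 1) : ℝ) : ℂ) •
                eD (N+1) (I+1) (J-1)
              + ((-((muU (N-1) - muD N) * bM q (nn N) (nn I) (nn J) 0 1) : ℝ) : ℂ) •
                eU (N-1) (I+1) (J-1)
              + ((-((muD (N-1) - muD N) * bM q (nn N) (nn I) (nn J) 1 1) : ℝ) : ℂ) •
                eD (N-1) (I+1) (J-1)) := by
  obtain ⟨T₁, hU₁, hD₁⟩ := exists_clm_of_bounded_entries 1 1
    (fun N I J k l => (mu k (N + 1) - mu l N) * aP q (nn N) (nn I) (nn J) k l)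
    (fun N I J k l => (mu k (N + -1) - mu l N) * aM q (nn N) (nn I) (nn J) k l) (commBound q)
    (fun N I J h k => by
      obtain ⟨h1, h2, h3⟩ := validU.bounds h
      exact ⟨abs_comm_aP_le hq0 hq1 h1 h3 k 0, abs_comm_aM_le hq0 hq1 h1 h2 h3 k 0 (by simp)⟩)
    (fun N I J h k => by
      obtain ⟨h1, h2, h3⟩ := validD.bounds h
      have h0 := zero_le_one.trans h1
      exact ⟨abs_comm_aP_le hq0 hq1 h0 h3 k 1,
        abs_comm_aM_le hq0 hq1 h0 h2 h3 k 1 fun _ => h1⟩)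
  obtain ⟨T₂, hU₂, hD₂⟩ := exists_clm_of_bounded_entries 1 (-1)
    (fun N I J k l => -((mu k (N + 1) - mu l N) * bP q (nn N) (nn I) (nn J) k l))
    (fun N I J k l => -((mu k (N + -1) - mu l N) * bM q (nn N) (nn I) (nn J) k l)) (commBound q)
    (fun N I J h k => by
      obtain ⟨h1, h2, h3⟩ := validU.bounds h
      rw [abs_neg, abs_neg]
      exact ⟨abs_comm_bP_le hq0 hq1 h1 h3 k 0, abs_comm_bM_le hq0 hq1 h1 h2 h3 k 0 (by simp)⟩)
    (fun N I J h k => by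
      obtain ⟨h1, h2, h3⟩ := validD.bounds h
      have h0 := zero_le_one.trans h1
      rw [abs_neg, abs_neg]
      exact ⟨abs_comm_bP_le hq0 hq1 h0 h3 k 1,
        abs_comm_bM_le hq0 hq1 h0 h2 h3 k 1 fun _ => h1⟩)
  exact ⟨T₁, T₂, fun N I J h => ⟨hU₁ N I J h, hU₂ N I J h⟩,
    fun N I J h => ⟨hD₁ N I J h, hD₂ N I J h⟩⟩
end
end
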